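/- arXiv:2008.03583 — 2 statements merged into one kernel-verified Lean document; each statement's English description precedes it below -/
import Mathlib

section
/- If A is a separable unital AF C*-algebra and B is either a unital AF C*-algebra or a von Neumann algebra, then for every ρ ∈ Rep(A,B), the closure U_B(ρ)⁻ of the unitary orbit of ρ in the topology of pointwise norm convergence is path-connected. -/
/-- A unital C*-algebra is AF if it is the closure of the union of an increasing sequence of
finite-dimensional unital C*-subalgebras (each containing the unit). -/
def IsAFAlgebra (A : Type*) [CStarAlgebra A] : Prop :=
  ∃ 𝒜 : ℕ → StarSubalgebra ℂ A, Monotone 𝒜 ∧ (∀ n, FiniteDimensional ℂ (𝒜 n)) ∧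
    closure (⋃ n, ((𝒜 n : Set A))) = Set.univ

/-- The unitary orbit of a unital *-homomorphism `π : A → B`, as a set of functions `A → B`
(with the topology of pointwise norm convergence, i.e. the product topology). -/
def unitaryOrbit {A B : Type*} [CStarAlgebra A] [CStarAlgebra B] (π : A →⋆ₐ[ℂ] B) :
    Set (A → B) :=
  {f | ∃ u ∈ unitary B, f = fun a => star u * π a * u}

/-- The unitary orbit of a representation `ρ : A → B(H)` taking values in a von Neumann
algebra `M`, under conjugation by unitaries of `M`. -/
def unitaryOrbitVN {A H : Type*} [CStarAlgebra A] [NormedAddCommGroup H]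
    [InnerProductSpace ℂ H] [CompleteSpace H] (M : VonNeumannAlgebra H)
    (ρ : A →⋆ₐ[ℂ] (H →L[ℂ] H)) : Set (A → (H →L[ℂ] H)) :=
  {f | ∃ u : H →L[ℂ] H, u ∈ M ∧ u ∈ unitary (H →L[ℂ] H) ∧ f = fun a => star u * ρ a * u}

open MeasureTheory Filter Topology

section NewtonIteration

theorem isUnit_and_norm_inverse_le_of_near {E : Type*} [NormedRing E] [CompleteSpace E] {a b : E}
    {k : ℝ} (ha : IsUnit a) (hk : ‖Ring.inverse a‖ ≤ k) (hab : k * ‖b - a‖ ≤ 1 / 2) :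
    IsUnit b ∧ ‖Ring.inverse b‖ ≤ 2 * k := by
  have hx : ‖Ring.inverse a * (a - b)‖ ≤ 1 / 2 := by
    refine (norm_mul_le _ _).trans (le_trans ?_ hab)
    rw [norm_sub_rev]
    gcongr
  have hb : b = a * (1 - Ring.inverse a * (a - b)) := by
    rw [mul_sub, ← mul_assoc, Ring.mul_inverse_cancel _ ha]; simp
  have hu : IsUnit b := by
    rw [hb]
    exact ha.mul (isUnit_one_sub_of_norm_lt_one (hx.trans_lt (by norm_num)))
  refine ⟨hu, ?_⟩
  have h2 : Ring.inverse b = Ring.inverse a + Ring.inverse a * (a - b) * Ring.inverse b := by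
    rw [mul_sub, sub_mul, Ring.inverse_mul_cancel _ ha, mul_assoc, Ring.mul_inverse_cancel _ hu]
    simp
  have h3 : ‖Ring.inverse b‖ ≤ k + 1 / 2 * ‖Ring.inverse b‖ := by
    calc ‖Ring.inverse b‖ = ‖Ring.inverse a + Ring.inverse a * (a - b) * Ring.inverse b‖ := by
          rw [← h2]
      _ ≤ ‖Ring.inverse a‖ + ‖Ring.inverse a * (a - b)‖ * ‖Ring.inverse b‖ :=
          (norm_add_le _ _).trans (add_le_add le_rfl (norm_mul_le _ _))
      _ ≤ _ := by gcongr
  linarith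

variable {G : Type*} [Group G] [TopologicalSpace G] [IsTopologicalGroup G] [CompactSpace G]
  [SecondCountableTopology G] [MeasurableSpace G] [BorelSpace G]
  (μ : Measure G) [IsProbabilityMeasure μ]
  {E : Type*} [NormedRing E] [NormedAlgebra ℝ E] [CompleteSpace E]

theorem Continuous.integrable_of_compactSpace {F : Type*} [NormedAddCommGroup F] {f : G → F}
    (hf : Continuous f) : Integrable f μ :=
  hf.integrable_of_hasCompactSupport (HasCompactSupport.of_compactSpace f)

theorem norm_integral_sub_le_of_forall {F : Type*} [NormedAddCommGroup F] [NormedSpace ℝ F]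
    [CompleteSpace F] {f : G → F}
    (hf : Continuous f) {c : F} {δ : ℝ} (h : ∀ g, ‖f g - c‖ ≤ δ) : ‖∫ g, f g ∂μ - c‖ ≤ δ := by
  have : ∫ g, f g ∂μ - c = ∫ g, (f g - c) ∂μ := by
    rw [integral_sub (hf.integrable_of_compactSpace μ) (integrable_const c)]
    simp
  rw [this]
  simpa using norm_integral_le_of_norm_le_const (μ := μ) (Eventually.of_forall h)

/-- One step of the averaging procedure that corrects an almost multiplicative map. -/
noncomputable def averagedCorrection (T : G → E) (g : G) : E :=
  ∫ h, T (g * h) * Ring.inverse (T h) ∂μ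

omit [NormedAlgebra ℝ E] in
theorem continuous_inverse_comp {X : Type*} [TopologicalSpace X] {T : X → E} (hT : Continuous T)
    (hu : ∀ g, IsUnit (T g)) : Continuous fun g => Ring.inverse (T g) := by
  rw [continuous_iff_continuousAt]
  intro g
  obtain ⟨u, hu⟩ := hu g
  have := NormedRing.inverse_continuousAt u
  rw [hu] at this
  exact ContinuousAt.comp this hT.continuousAt

theorem continuous_averagedCorrection {T : G → E} (hT : Continuous T) (hu : ∀ g, IsUnit (T g)) :
    Continuous (averagedCorrection μ T) := by
  have hi := continuous_inverse_comp hT hu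
  have hc : Continuous (Function.uncurry fun g h => T (g * h) * Ring.inverse (T h)) := by
    simp only [Function.uncurry_def]
    exact (hT.comp (by fun_prop)).mul (hi.comp continuous_snd)
  have := continuous_parametric_integral_of_continuous (μ := μ) hc isCompact_univ
  simp only [Measure.restrict_univ] at this
  exact this

theorem norm_averagedCorrection_sub_le {T : G → E} (hT : Continuous T) (hu : ∀ g, IsUnit (T g))
    {K δ : ℝ} (hK : ∀ g, ‖Ring.inverse (T g)‖ ≤ K)
    (hδ : ∀ g h, ‖T (g * h) - T g * T h‖ ≤ δ) (g : G) :
    ‖averagedCorrection μ T g - T g‖ ≤ δ * K ∧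
      ∀ h, ‖T (g * h) * Ring.inverse (T h) - T g‖ ≤ δ * K := by
  have hi := continuous_inverse_comp hT hu
  have key : ∀ h, ‖T (g * h) * Ring.inverse (T h) - T g‖ ≤ δ * K := by
    intro h
    have : T (g * h) * Ring.inverse (T h) - T g = (T (g * h) - T g * T h) * Ring.inverse (T h) := by
      rw [sub_mul, mul_assoc (T g), Ring.mul_inverse_cancel _ (hu h), mul_one]
    rw [this]
    refine (norm_mul_le _ _).trans ?_
    gcongr
    · exact (norm_nonneg _).trans (hδ g h)
    · exact hδ g h
    · exact hK h
  exact ⟨norm_integral_sub_le_of_forall μ ((hT.comp (by fun_prop)).mul hi) key, key⟩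

theorem averagedCorrection_mul_sub_le [μ.IsMulLeftInvariant] {T : G → E} (hT : Continuous T)
    (hu : ∀ g, IsUnit (T g))
    {K δ : ℝ} (hK : ∀ g, ‖Ring.inverse (T g)‖ ≤ K)
    (hδ : ∀ g h, ‖T (g * h) - T g * T h‖ ≤ δ) (k g : G) :
    ‖averagedCorrection μ T (k * g) - averagedCorrection μ T k * averagedCorrection μ T g‖
      ≤ (2 * (δ * K)) ^ 2 := by
  have hi := continuous_inverse_comp hT hu
  set S := averagedCorrection μ T with hS
  set r : G → G → E := fun g h => T (g * h) * Ring.inverse (T h) - S g with hr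
  have hrc : ∀ g, Continuous (r g) := fun g =>
    ((hT.comp (by fun_prop)).mul hi).sub continuous_const
  have hrb : ∀ g h, ‖r g h‖ ≤ 2 * (δ * K) := by
    intro g h
    obtain ⟨h1, h2⟩ := norm_averagedCorrection_sub_le μ hT hu hK hδ g
    have : r g h = (T (g * h) * Ring.inverse (T h) - T g) - (S g - T g) := by
      simp only [hr]; abel
    rw [this]
    refine (norm_sub_le _ _).trans ?_
    linarith [h2 h]
  have hr0 : ∀ g, ∫ h, r g h ∂μ = 0 := by
    intro g
    have h1 : Continuous fun h => T (g * h) * Ring.inverse (T h) := (hT.comp (by fun_prop)).mul hi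
    simp only [hr]
    rw [integral_sub (h1.integrable_of_compactSpace μ) (integrable_const _)]
    simp [hS, averagedCorrection]
  have hr0' : ∫ h, r k (g * h) ∂μ = 0 := by
    rw [integral_mul_left_eq_self (fun h => r k h) g, hr0]
  have hrc' : Continuous fun h => r k (g * h) := (hrc k).comp (by fun_prop)
  have expand : ∀ h, r k (g * h) * r g h = (S (k * g) - S k * S g) + r (k * g) h
      - r k (g * h) * S g - S k * r g h := by
    intro h
    have e : ∀ g h, T (g * h) = (S g + r g h) * T h := by
      intro g h
      simp only [hr, add_sub_cancel]
      rw [mul_assoc, Ring.inverse_mul_cancel _ (hu h), mul_one]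
    have e2 : S (k * g) + r (k * g) h = (S k + r k (g * h)) * (S g + r g h) := by
      have h1 : (S (k * g) + r (k * g) h) * T h = (S k + r k (g * h)) * (S g + r g h) * T h := by
        rw [← e, mul_assoc (S k + _), ← e, ← e, mul_assoc]
      exact (hu h).mul_left_injective h1
    have e3 : r k (g * h) * r g h = (S k + r k (g * h)) * (S g + r g h) - S k * S g
        - r k (g * h) * S g - S k * r g h := by noncomm_ring
    rw [e3, ← e2]
    abel
  have hint : ∫ h, r k (g * h) * r g h ∂μ = S (k * g) - S k * S g := by
    simp_rw [expand]
    have i0 : Integrable (fun h => r (k * g) h) μ := (hrc _).integrable_of_compactSpace μ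
    have i1 : Integrable (fun h => r k (g * h) * S g) μ :=
      (hrc'.mul continuous_const).integrable_of_compactSpace μ
    have i2 : Integrable (fun h => S k * r g h) μ :=
      (continuous_const.mul (hrc _)).integrable_of_compactSpace μ
    have j0 : Integrable (fun h => S (k * g) - S k * S g + r (k * g) h) μ :=
      (integrable_const _).add i0
    have j1 : Integrable (fun h => S (k * g) - S k * S g + r (k * g) h - r k (g * h) * S g) μ :=
      j0.sub i1
    rw [integral_sub j1 i2, integral_sub j0 i1, integral_add (integrable_const _) i0,
      integral_mul_const_of_integrable (hrc'.integrable_of_compactSpace μ),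
      integral_const_mul_of_integrable ((hrc g).integrable_of_compactSpace μ), hr0, hr0', hr0]
    simp
  rw [← hint]
  have := norm_integral_le_of_norm_le_const (μ := μ) (f := fun h => r k (g * h) * r g h)
    (C := (2 * (δ * K)) ^ 2) (Eventually.of_forall fun h => by
      rw [sq]
      refine (norm_mul_le _ _).trans ?_
      gcongr
      · exact (norm_nonneg _).trans (hrb 1 1)
      · exact hrb _ _
      · exact hrb _ _)
  simpa using this

/-- Almost multiplicative maps from a compact group are close to representations. -/
theorem exists_monoidHom_near_of_almost_multiplicative [μ.IsMulLeftInvariant] {T : G → E}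
    (hT : Continuous T) (hu : ∀ g, IsUnit (T g)) (hK : ∀ g, ‖Ring.inverse (T g)‖ ≤ 2)
    {δ : ℝ} (hδ : ∀ g h, ‖T (g * h) - T g * T h‖ ≤ δ) (hδs : δ ≤ 1 / 128) :
    ∃ S : G →* E, Continuous S ∧ ∀ g, ‖S g - T g‖ ≤ 8 * δ := by
  have hδ0 : 0 ≤ δ := (norm_nonneg _).trans (hδ 1 1)
  set Q : ℕ → G → E := fun n => (averagedCorrection μ)^[n] T with hQ
  have Qs : ∀ n, Q (n + 1) = averagedCorrection μ (Q n) := fun n =>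
    Function.iterate_succ_apply' _ _ _
  have near : ∀ n, (∀ g, ‖Q n g - T g‖ ≤ 8 * δ * (1 - (1 / 2) ^ n)) →
      ∀ g, IsUnit (Q n g) ∧ ‖Ring.inverse (Q n g)‖ ≤ 4 := by
    intro n hn g
    have hp : (0 : ℝ) ≤ (1 / 2) ^ n := by positivity
    have := isUnit_and_norm_inverse_le_of_near (hu g) (hK g) (b := Q n g) (by nlinarith [hn g])
    exact ⟨this.1, this.2.trans (by norm_num)⟩
  have inv : ∀ n, Continuous (Q n) ∧ (∀ g, ‖Q n g - T g‖ ≤ 8 * δ * (1 - (1 / 2) ^ n)) ∧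
      ∀ g h, ‖Q n (g * h) - Q n g * Q n h‖ ≤ δ * (1 / 2) ^ n := by
    intro n
    induction n with
    | zero => simpa [hQ] using ⟨hT, hδ⟩
    | succ n ih =>
      obtain ⟨c, d, m⟩ := ih
      have hun := near n d
      have hp : (0 : ℝ) ≤ (1 / 2) ^ n := by positivity
      have hp1 : ((1 : ℝ) / 2) ^ n ≤ 1 := pow_le_one₀ (by norm_num) (by norm_num)
      rw [Qs]
      refine ⟨continuous_averagedCorrection μ c fun g => (hun g).1, fun g => ?_, fun g h => ?_⟩
      · have h1 := (norm_averagedCorrection_sub_le μ c (fun g => (hun g).1)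
          (fun g => (hun g).2) m g).1
        calc _ = ‖(averagedCorrection μ (Q n) g - Q n g) + (Q n g - T g)‖ := by simp
          _ ≤ δ * (1 / 2) ^ n * 4 + 8 * δ * (1 - (1 / 2) ^ n) :=
            (norm_add_le _ _).trans (add_le_add h1 (d g))
          _ = _ := by ring
      · refine (averagedCorrection_mul_sub_le μ c (fun g => (hun g).1)
          (fun g => (hun g).2) m g h).trans ?_
        have : (2 * (δ * (1 / 2) ^ n * 4)) ^ 2 = 64 * (δ * (1 / 2) ^ n) * (δ * (1 / 2) ^ n) := by
          ring
        rw [this, pow_succ, ← mul_assoc]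
        have h3 : δ * (1 / 2) ^ n ≤ 1 / 128 := by nlinarith
        have h4 : 0 ≤ δ * (1 / 2) ^ n := by positivity
        nlinarith
  have step : ∀ g n, dist (Q n g) (Q (n + 1) g) ≤ (4 * δ) * (1 / 2) ^ n := by
    intro g n
    obtain ⟨c, d, m⟩ := inv n
    have hun := near n d
    have h1 := (norm_averagedCorrection_sub_le μ c (fun g => (hun g).1)
          (fun g => (hun g).2) m g).1
    rw [dist_comm, dist_eq_norm, Qs]
    linarith
  have lim : ∀ g, ∃ y, Tendsto (fun n => Q n g) atTop (𝓝 y) := fun g =>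
    cauchySeq_tendsto_of_complete (cauchySeq_of_le_geometric _ _ (by norm_num) (step g))
  choose S hS using lim
  have hSn : ∀ g n, dist (Q n g) (S g) ≤ 8 * δ * (1 / 2) ^ n := by
    intro g n
    have := dist_le_of_le_geometric_of_tendsto _ _ (by norm_num) (step g) (hS g) n
    refine this.trans (le_of_eq (by ring))
  have t0 : Tendsto (fun n : ℕ => 8 * δ * (1 / 2 : ℝ) ^ n) atTop (𝓝 0) := by
    simpa using (tendsto_pow_atTop_nhds_zero_of_lt_one (r := (1 / 2 : ℝ)) (by norm_num)
      (by norm_num)).const_mul (8 * δ)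
  have t0' : Tendsto (fun n : ℕ => δ * (1 / 2 : ℝ) ^ n) atTop (𝓝 0) := by
    simpa using (tendsto_pow_atTop_nhds_zero_of_lt_one (r := (1 / 2 : ℝ)) (by norm_num)
      (by norm_num)).const_mul δ
  have unif : TendstoUniformly Q S atTop := by
    rw [Metric.tendstoUniformly_iff]
    intro ε hε
    filter_upwards [t0.eventually (gt_mem_nhds hε)] with n hn g
    rw [dist_comm]
    exact (hSn g n).trans_lt hn
  have hSc : Continuous S := unif.continuous (Frequently.of_forall fun n => (inv n).1)
  have hST : ∀ g, ‖S g - T g‖ ≤ 8 * δ := by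
    intro g
    have := hSn g 0
    rw [dist_comm, dist_eq_norm] at this
    simpa [hQ] using this
  have hmul : ∀ g h, S (g * h) = S g * S h := by
    intro g h
    have h1 : Tendsto (fun n => ‖Q n (g * h) - Q n g * Q n h‖) atTop (𝓝 0) :=
      squeeze_zero (fun _ => norm_nonneg _) (fun n => (inv n).2.2 g h) t0'
    have h2 := ((hS (g * h)).sub ((hS g).mul (hS h))).norm
    exact sub_eq_zero.1 (norm_eq_zero.1 (tendsto_nhds_unique h2 h1))
  have hone : S 1 = 1 := by
    have hun := (isUnit_and_norm_inverse_le_of_near (hu 1) (hK 1) (b := S 1)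
      (by linarith [hST 1])).1
    have := hmul 1 1
    rw [mul_one] at this
    exact hun.mul_left_cancel (by rw [← this, mul_one])
  exact ⟨⟨⟨S, hone⟩, hmul⟩, hSc, hST⟩

end NewtonIteration

section Averaging

variable {G : Type*} [Group G] [TopologicalSpace G] [IsTopologicalGroup G] [CompactSpace G]
  [SecondCountableTopology G] [MeasurableSpace G] [BorelSpace G]
  (μ : Measure G) [IsProbabilityMeasure μ] [μ.IsMulLeftInvariant]
  {E : Type*} [NormedRing E] [NormedAlgebra ℝ E] [CompleteSpace E]

theorem MonoidHom.mul_map_inv {G M : Type*} [Group G] [Monoid M] (P : G →* M) (g : G) :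
    P g * P g⁻¹ = 1 := by
  rw [← map_mul, mul_inv_cancel, map_one]

include μ in
/-- Nearby representations of a compact group are similar. -/
theorem exists_isUnit_intertwiner_of_near {P Q : G →* E} (hP : Continuous P) (hQ : Continuous Q)
    (hP1 : ∀ g, ‖P g‖ ≤ 1) {δ : ℝ} (hδ : δ < 1) (hPQ : ∀ g, ‖Q g - P g‖ ≤ δ) :
    ∃ s : E, IsUnit s ∧ ∀ h, P h * s = s * Q h := by
  have hc : Continuous fun g => P g * Q g⁻¹ := hP.mul (hQ.comp continuous_inv)
  refine ⟨∫ g, P g * Q g⁻¹ ∂μ, ?_, fun h => ?_⟩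
  · have key : ∀ g, ‖P g * Q g⁻¹ - 1‖ ≤ δ := by
      intro g
      have : P g * Q g⁻¹ - 1 = P g * (Q g⁻¹ - P g⁻¹) := by
        rw [mul_sub, P.mul_map_inv]
      rw [this]
      refine (norm_mul_le _ _).trans ?_
      nlinarith [hP1 g, hPQ g⁻¹, norm_nonneg (P g), norm_nonneg (Q g⁻¹ - P g⁻¹)]
    have h1 := norm_integral_sub_le_of_forall μ hc key
    rw [← sub_sub_cancel 1 (∫ g, P g * Q g⁻¹ ∂μ)]
    refine isUnit_one_sub_of_norm_lt_one ?_
    rw [norm_sub_rev]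
    exact h1.trans_lt hδ
  · have hi := hc.integrable_of_compactSpace μ
    rw [← integral_const_mul_of_integrable hi, ← integral_mul_const_of_integrable hi,
      ← integral_mul_left_eq_self (fun g => P g * Q g⁻¹ * Q h) h]
    refine integral_congr_ae (Eventually.of_forall fun g => ?_)
    simp only [map_mul, mul_inv_rev, mul_assoc]
    rw [← map_mul Q h⁻¹ h, inv_mul_cancel, map_one, mul_one]

/-- The average of `x` over conjugation by the representation `T`. -/
noncomputable def conjAverage (T : G →* E) (x : E) : E :=
  ∫ g, T g * x * T g⁻¹ ∂μ

variable {T : G →* E} (hT : Continuous T)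
include hT

omit [CompactSpace G] [SecondCountableTopology G] [MeasurableSpace G] [BorelSpace G]
  [NormedAlgebra ℝ E] [CompleteSpace E] in
theorem continuous_conj (x : E) : Continuous fun g => T g * x * T g⁻¹ :=
  (hT.mul continuous_const).mul (hT.comp continuous_inv)

omit [CompleteSpace E] in
theorem commute_conjAverage (x : E) (h : G) : Commute (conjAverage μ T x) (T h) := by
  have hi := (continuous_conj hT x).integrable_of_compactSpace μ
  rw [commute_iff_eq, conjAverage, eq_comm, ← integral_const_mul_of_integrable hi,
    ← integral_mul_const_of_integrable hi,
    ← integral_mul_left_eq_self (fun g => T g * x * T g⁻¹ * T h) h]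
  refine integral_congr_ae (Eventually.of_forall fun g => ?_)
  simp only [map_mul, mul_inv_rev, mul_assoc]
  rw [← map_mul T h⁻¹ h, inv_mul_cancel, map_one, mul_one]

omit [μ.IsMulLeftInvariant] in
theorem norm_conjAverage_sub_le {C : ℝ} (hC : ∀ g, ‖T g‖ ≤ C) (x : E) {z : E}
    (hz : ∀ g, Commute z (T g)) : ‖conjAverage μ T x - z‖ ≤ C * ‖x - z‖ * C := by
  refine norm_integral_sub_le_of_forall μ (continuous_conj hT x) fun g => ?_
  have : T g * x * T g⁻¹ - z = T g * (x - z) * T g⁻¹ := by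
    rw [mul_sub, sub_mul, ← (hz g).eq, mul_assoc z, T.mul_map_inv, mul_one]
  rw [this]
  have hC0 : 0 ≤ C := (norm_nonneg _).trans (hC 1)
  refine (norm_mul_le _ _).trans ?_
  gcongr
  · exact (norm_mul_le _ _).trans (by gcongr; exact hC g)
  · exact hC _

omit [μ.IsMulLeftInvariant] in
theorem conjAverage_mem {S : Type*} [SetLike S E] [SubringClass S E] [SMulMemClass S ℝ E] {s : S}
    (hs : IsClosed (s : Set E)) (hTs : ∀ g, T g ∈ s) {x : E} (hx : x ∈ s) :
    conjAverage μ T x ∈ s := by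
  have hconv : Convex ℝ (s : Set E) := fun a ha b hb p q _ _ _ =>
    add_mem (SMulMemClass.smul_mem p ha) (SMulMemClass.smul_mem q hb)
  exact hconv.integral_mem hs
    (Eventually.of_forall fun g => mul_mem (mul_mem (hTs g) hx) (hTs _))
    ((continuous_conj hT x).integrable_of_compactSpace μ)

end Averaging

section PolarDecomposition

variable {B : Type*} [CStarAlgebra B]

/-- The unitary part in the polar decomposition of an invertible element. -/
noncomputable def unitaryPart (x : B) : B :=
  x * cfc (fun t : ℝ => (√t)⁻¹) (star x * x)

theorem pos_of_mem_spectrum_star_mul_self {x : B} (hx : IsUnit x) {t : ℝ}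
    (ht : t ∈ spectrum ℝ (star x * x)) : 0 < t := by
  refine lt_of_le_of_ne (spectrum_star_mul_self_nonneg t ht) ?_
  rintro rfl
  exact (spectrum.zero_notMem_iff ℝ).2 (hx.star.mul hx) ht

theorem continuousOn_inv_sqrt : ContinuousOn (fun t : ℝ => (√t)⁻¹) (Set.Ioi 0) :=
  Real.continuous_sqrt.continuousOn.inv₀ fun _ ht => (Real.sqrt_pos.2 ht).ne'

theorem continuousOn_unitaryPart : ContinuousOn (unitaryPart (B := B)) {x | IsUnit x} := by
  refine continuousOn_id.mul ?_
  refine ContinuousOn.cfc_of_mem_nhdsSet (s := Set.Ioi 0) _ ?_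
    (Continuous.continuousOn (by fun_prop)) (fun x _ => .star_mul_self x) continuousOn_inv_sqrt
  rw [isOpen_Ioi.mem_nhdsSet]
  simp only [Set.iUnion_subset_iff]
  exact fun x hx t ht => pos_of_mem_spectrum_star_mul_self hx ht

theorem unitaryPart_mem_unitary {x : B} (hx : IsUnit x) : unitaryPart x ∈ unitary B := by
  set a := star x * x with ha
  have hsa : IsSelfAdjoint a := .star_mul_self x
  set f : ℝ → ℝ := fun t => (√t)⁻¹ with hf
  have hfc : ContinuousOn f (spectrum ℝ a) :=
    continuousOn_inv_sqrt.mono fun t ht => pos_of_mem_spectrum_star_mul_self hx ht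
  have hfaf : cfc f a * a * cfc f a = 1 := by
    nth_rw 2 [← cfc_id' ℝ a]
    rw [← cfc_mul f _ a, ← cfc_mul _ f a, ← cfc_one ℝ a]
    refine cfc_congr fun t ht => ?_
    have hp := pos_of_mem_spectrum_star_mul_self hx ht
    have := Real.mul_self_sqrt hp.le
    have := Real.sqrt_pos.2 hp
    simp only [hf, Pi.one_apply]
    field_simp
    nlinarith
  have hcomm : Commute a (cfc f a) := (hsa.commute_cfc (Commute.refl a) f).symm
  have hfu : IsUnit (cfc f a) := by
    refine isUnit_iff_exists.2 ⟨a * cfc f a, by rw [← mul_assoc, hfaf], ?_⟩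
    rw [hcomm.eq, hfaf]
  have h1 : star (unitaryPart x) * unitaryPart x = 1 := by
    rw [unitaryPart, star_mul, ← ha, (cfc_predicate f a : IsSelfAdjoint _).star_eq, ← hfaf, ha]
    simp only [mul_assoc, hf]
  obtain ⟨u, hu⟩ : IsUnit (unitaryPart x) := hx.mul hfu
  refine Unitary.mem_iff.2 ⟨h1, ?_⟩
  rw [← hu] at h1 ⊢
  rw [← Units.inv_eq_of_mul_eq_one_left h1, u.mul_inv]

/-- Replacing an invertible intertwiner by its unitary part. -/
theorem mul_unitaryPart_eq {x p q p' q' : B} (h : p * x = x * q) (h' : p' * x = x * q')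
    (hp : star p = p') (hq : star q = q') : p * unitaryPart x = unitaryPart x * q := by
  have h1 : star x * p = q * star x := by
    have := congrArg star h'
    rw [star_mul, star_mul, ← hp, ← hq, star_star, star_star] at this
    exact this
  have hc : Commute (star x * x) q := by
    rw [commute_iff_eq, mul_assoc, ← h, ← mul_assoc, h1, mul_assoc]
  rw [unitaryPart, ← mul_assoc, h, mul_assoc, mul_assoc, (hc.cfc_real _).eq]

theorem unitaryPart_of_mem_unitary {x : B} (hx : x ∈ unitary B) : unitaryPart x = x := by
  simp [unitaryPart, Unitary.star_mul_self_of_mem hx]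

end PolarDecomposition

section Approximation

variable {G : Type*} [Group G] [TopologicalSpace G] [IsTopologicalGroup G] [CompactSpace G]
  [SecondCountableTopology G] [MeasurableSpace G] [BorelSpace G]
  (μ : Measure G) [IsProbabilityMeasure μ] [μ.IsMulLeftInvariant]
  {B : Type*} [CStarAlgebra B]

theorem exists_continuous_near_of_dense {G : Type*} [TopologicalSpace G] [CompactSpace G]
    [T2Space G] {𝓑 : ℕ → StarSubalgebra ℂ B} (hmono : Monotone 𝓑)
    (hdense : closure (⋃ n, (𝓑 n : Set B)) = Set.univ) {R : G → B} (hR : Continuous R)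
    {ε : ℝ} (hε : 0 < ε) : ∃ m, ∃ T : G → B, Continuous T ∧ ∀ g, T g ∈ 𝓑 m ∧ ‖T g - R g‖ ≤ ε := by
  have hex : ∀ x : B, ∃ m, ∃ b ∈ 𝓑 m, dist b x < ε := by
    intro x
    have : x ∈ closure (⋃ n, (𝓑 n : Set B)) := hdense ▸ Set.mem_univ x
    obtain ⟨b, hb, hbx⟩ := Metric.mem_closure_iff.1 this ε hε
    obtain ⟨m, hm⟩ := Set.mem_iUnion.1 hb
    exact ⟨m, b, hm, by rwa [dist_comm]⟩
  obtain ⟨m, hm⟩ : ∃ m, ∀ g, ∃ b ∈ 𝓑 m, dist b (R g) < ε := by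
    have hopen : ∀ m, IsOpen {g | ∃ b ∈ 𝓑 m, dist b (R g) < ε} := by
      intro m
      have : {g | ∃ b ∈ 𝓑 m, dist b (R g) < ε} = ⋃ b ∈ 𝓑 m, {g | dist b (R g) < ε} := by
        ext; simp
      rw [this]
      exact isOpen_biUnion fun b _ => isOpen_lt (by fun_prop) continuous_const
    obtain ⟨m, hm⟩ := isCompact_univ.elim_directed_cover _ hopen
      (fun g _ => Set.mem_iUnion.2 (hex (R g)))
      (directed_of_isDirected_le fun i j hij g ⟨b, hb, hbg⟩ => ⟨b, hmono hij hb, hbg⟩)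
    exact ⟨m, fun g => hm (Set.mem_univ g)⟩
  obtain ⟨T, hT⟩ := exists_continuous_forall_mem_convex_of_local_const
    (t := fun g => (𝓑 m : Set B) ∩ Metric.ball (R g) ε) (fun g => by
      refine Convex.inter (fun a ha b hb p q _ _ _ => ?_) (convex_ball _ _)
      exact add_mem (SMulMemClass.smul_mem (p : ℂ) ha) (SMulMemClass.smul_mem (q : ℂ) hb))
    (fun g => by
      obtain ⟨b, hb, hbg⟩ := hm g
      refine ⟨b, ?_⟩
      have : ∀ᶠ h in 𝓝 g, dist b (R h) < ε :=
        (isOpen_lt (by fun_prop) continuous_const).mem_nhds hbg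
      filter_upwards [this] with h hh using ⟨hb, hh⟩)
  exact ⟨m, T, T.continuous, fun g => ⟨(hT g).1, by
    rw [← dist_eq_norm]; exact (Metric.mem_ball.1 (hT g).2).le⟩⟩

include μ in
/-- A representation of a compact group in an AF algebra is similar to one in a finite-dimensional
subalgebra. -/
theorem exists_similar_monoidHom_mem {𝓑 : ℕ → StarSubalgebra ℂ B} (hmono : Monotone 𝓑)
    (hfin : ∀ n, FiniteDimensional ℂ (𝓑 n))
    (hdense : closure (⋃ n, (𝓑 n : Set B)) = Set.univ) {R : G →* B} (hR : Continuous R)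
    (hR1 : ∀ g, ‖R g‖ ≤ 1) [T2Space G] : ∃ m, ∃ T : G →* B, Continuous T ∧ (∀ g, T g ∈ 𝓑 m) ∧
      (∀ g, ‖T g‖ ≤ 2) ∧ ∃ s, IsUnit s ∧ ∀ h, R h * s = s * T h := by
  obtain ⟨m, T₀, hT₀, hT₀m⟩ := exists_continuous_near_of_dense hmono hdense hR
    (ε := 1 / 1000) (by norm_num)
  have hcl : IsClosed (𝓑 m : Set B) := (𝓑 m).toSubmodule.closed_of_finiteDimensional
  set T₁ : G → 𝓑 m := fun g => ⟨T₀ g, (hT₀m g).1⟩ with hT₁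
  have hT₁c : Continuous T₁ := hT₀.subtype_mk _
  have hunit : ∀ g, IsUnit (T₁ g) ∧ ‖Ring.inverse (T₁ g)‖ ≤ 2 := by
    intro g
    have hRu : IsUnit (R g) :=
      isUnit_iff_exists.2 ⟨R g⁻¹, R.mul_map_inv g, by simpa using R.mul_map_inv g⁻¹⟩
    have hRi : Ring.inverse (R g) = R g⁻¹ := by
      refine hRu.mul_left_cancel ?_
      rw [Ring.mul_inverse_cancel _ hRu, R.mul_map_inv]
    obtain ⟨h1, h2⟩ := isUnit_and_norm_inverse_le_of_near hRu (k := 1) (b := T₀ g)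
      (by rw [hRi]; exact hR1 _) (by linarith [(hT₀m g).2])
    have h3 : IsUnit (T₁ g) := (𝓑 m).coe_isUnit.1 h1
    refine ⟨h3, ?_⟩
    have h4 : ((Ring.inverse (T₁ g) : 𝓑 m) : B) = Ring.inverse (T₀ g) := by
      refine h1.mul_left_cancel ?_
      rw [Ring.mul_inverse_cancel _ h1]
      exact congrArg Subtype.val (Ring.mul_inverse_cancel _ h3)
    calc ‖Ring.inverse (T₁ g)‖ = ‖Ring.inverse (T₀ g)‖ := by rw [← h4]; rfl
      _ ≤ 2 := by linarith
  have hdefect : ∀ g h, ‖T₁ (g * h) - T₁ g * T₁ h‖ ≤ 4 / 1000 := by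
    intro g h
    have : ‖T₀ (g * h) - T₀ g * T₀ h‖ ≤ 4 / 1000 := by
      have e : T₀ (g * h) - T₀ g * T₀ h = (T₀ (g * h) - R (g * h)) - (T₀ g - R g) * R h
          - (T₀ g - R g) * (T₀ h - R h) - R g * (T₀ h - R h) := by
        rw [map_mul]; noncomm_ring
      have d1 := (hT₀m (g * h)).2
      have d2 := (hT₀m g).2
      have d3 := (hT₀m h).2
      rw [e]
      have a1 : ‖(T₀ g - R g) * R h‖ ≤ 1 / 1000 * 1 :=
        (norm_mul_le _ _).trans (mul_le_mul d2 (hR1 h) (norm_nonneg _) (by norm_num))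
      have a2 : ‖(T₀ g - R g) * (T₀ h - R h)‖ ≤ 1 / 1000 * (1 / 1000) :=
        (norm_mul_le _ _).trans (mul_le_mul d2 d3 (norm_nonneg _) (by norm_num))
      have a3 : ‖R g * (T₀ h - R h)‖ ≤ 1 * (1 / 1000) :=
        (norm_mul_le _ _).trans (mul_le_mul (hR1 g) d3 (norm_nonneg _) (by norm_num))
      have b1 := norm_sub_le ((T₀ (g * h) - R (g * h)) - (T₀ g - R g) * R h
          - (T₀ g - R g) * (T₀ h - R h)) (R g * (T₀ h - R h))
      have b2 := norm_sub_le ((T₀ (g * h) - R (g * h)) - (T₀ g - R g) * R h)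
          ((T₀ g - R g) * (T₀ h - R h))
      have b3 := norm_sub_le (T₀ (g * h) - R (g * h)) ((T₀ g - R g) * R h)
      linarith
    exact this
  obtain ⟨S, hS, hST⟩ := exists_monoidHom_near_of_almost_multiplicative μ hT₁c
    (fun g => (hunit g).1) (fun g => (hunit g).2) hdefect (by norm_num)
  let T : G →* B := ((𝓑 m).subtype : 𝓑 m →* B).comp S
  have hTc : Continuous T := continuous_subtype_val.comp hS
  have hTR : ∀ g, ‖T g - R g‖ ≤ 1 / 2 := by
    intro g
    have h1 : ‖T g - T₀ g‖ ≤ 8 * (4 / 1000) := hST g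
    have h2 := (hT₀m g).2
    have := norm_add_le (T g - T₀ g) (T₀ g - R g)
    rw [sub_add_sub_cancel] at this
    linarith
  refine ⟨m, T, hTc, fun g => (S g).2, fun g => ?_,
    exists_isUnit_intertwiner_of_near μ hR hTc hR1 (by norm_num) hTR⟩
  have := norm_add_le (T g - R g) (R g)
  rw [sub_add_cancel] at this
  linarith [hTR g, hR1 g]

theorem finite_spectrum_of_mem_finiteDimensional {S : StarSubalgebra ℂ B}
    [FiniteDimensional ℂ S] {y : B} (hy : y ∈ S) : (spectrum ℂ y).Finite := by
  obtain ⟨p, hp, hpy⟩ : IsIntegral ℂ (⟨y, hy⟩ : S) := Algebra.IsIntegral.isIntegral _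
  have hpy' : Polynomial.aeval y p = 0 := by
    have := congrArg S.subtype hpy
    simpa [← Polynomial.aeval_def, ← Polynomial.aeval_algHom_apply] using
      (Polynomial.aeval_algHom_apply (S.subtype : S →ₐ[ℂ] B) (⟨y, hy⟩ : S) p).trans this
  refine (Polynomial.rootSet_finite p ℂ).subset fun k hk => ?_
  have := spectrum.subset_polynomial_aeval y p ⟨k, hk, rfl⟩
  rw [hpy'] at this
  rw [Polynomial.mem_rootSet]
  refine ⟨hp.ne_zero, ?_⟩
  by_contra h
  refine this ?_
  have hu := (IsUnit.mk0 _ h).map (algebraMap ℂ B)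
  rw [spectrum.mem_resolventSet_iff, sub_zero]
  simpa using hu

/-- An invertible element of finite spectrum is joined to the unit through invertible elements of
the algebra it generates. -/
theorem joinedIn_one_of_finite_spectrum {y : B} (hy : IsUnit y) (hfin : (spectrum ℂ y).Finite)
    {C : Set B} (hC : ∀ c : ℂ, 1 + c • (y - 1) ∈ C) :
    JoinedIn {x | IsUnit x ∧ x ∈ C} y 1 := by
  set f : ℂ → B := fun c => 1 + c • (y - 1) with hf
  have hfc : Continuous f := by fun_prop
  set bad : Set ℂ := (fun l => (1 - l)⁻¹) '' spectrum ℂ y \ {0} with hbad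
  have hb : bad.Finite := (hfin.image _).sdiff
  have hgood : ∀ c ∈ badᶜ, IsUnit (f c) := by
    intro c hc
    by_cases hc0 : c = 0
    · simp [hf, hc0]
    by_contra hu
    refine hc ⟨⟨1 - c⁻¹, ?_, by simp⟩, hc0⟩
    intro hun
    refine hu ?_
    have : f c = (-c) • (algebraMap ℂ B (1 - c⁻¹) - y) := by
      simp only [hf, Algebra.algebraMap_eq_smul_one, smul_sub, sub_smul, smul_smul, neg_smul,
        neg_mul, mul_inv_cancel₀ hc0, one_smul]
      abel
    rw [this]
    exact hun.smul (Units.mk0 (-c) (neg_ne_zero.2 hc0))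
  have hpc : IsPathConnected badᶜ :=
    hb.countable.isPathConnected_compl_of_one_lt_rank (by simp)
  have h1 : (1 : ℂ) ∈ badᶜ := by
    rintro ⟨⟨l, hl, hl1⟩, -⟩
    have : l = 0 := by
      have := inv_eq_one.1 hl1
      linear_combination -this
    exact (spectrum.zero_notMem_iff ℂ).2 hy (this ▸ hl)
  have h0 : (0 : ℂ) ∈ badᶜ := fun h => h.2 rfl
  have := (hpc.joinedIn 1 h1 0 h0).map hfc
  simp only [hf] at this
  have h2 := this.mono (V := {x | IsUnit x ∧ x ∈ C}) (by
    rintro _ ⟨c, hc, rfl⟩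
    exact ⟨hgood c hc, hC c⟩)
  simpa using h2

include μ in
/-- In an AF algebra, invertible elements commuting with a representation of a compact group are
joined to the unit through such elements. -/
theorem joinedIn_one_of_isAFAlgebra (hB : IsAFAlgebra B) {R : G →* B} (hR : Continuous R)
    (hR1 : ∀ g, ‖R g‖ ≤ 1) [T2Space G] {z : B} (hz : IsUnit z) (hzR : ∀ g, Commute z (R g)) :
    JoinedIn {x | IsUnit x ∧ ∀ g, Commute x (R g)} z 1 := by
  obtain ⟨𝓑, hmono, hfin, hdense⟩ := hB
  obtain ⟨m, T, hT, hTm, hT2, s, hs, hRs⟩ :=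
    exists_similar_monoidHom_mem μ hmono hfin hdense hR hR1
  obtain ⟨s, rfl⟩ := hs
  have conj_unit : ∀ {s : Bˣ} {x : B}, IsUnit x → IsUnit (↑s⁻¹ * x * s) := fun h =>
    ((Units.isUnit _).mul h).mul (Units.isUnit _)
  set z' : B := ↑s⁻¹ * z * s with hz'
  have hz'u : IsUnit z' := conj_unit hz
  have hRT : ∀ g, T g = ↑s⁻¹ * R g * s := fun g => by
    rw [mul_assoc, hRs, Units.inv_mul_cancel_left]
  have hz'T : ∀ g, Commute z' (T g) := fun g => by
    rw [commute_iff_eq, hRT, hz']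
    simp only [mul_assoc, Units.mul_inv_cancel_left]
    rw [← mul_assoc z, (hzR g).eq, mul_assoc]
  obtain ⟨ε, hε, hball⟩ := Metric.isOpen_iff.1 (Units.isOpen (R := B)) z' hz'u
  obtain ⟨y₀, hy₀, hyz⟩ := Metric.mem_closure_iff.1
    (hdense ▸ Set.mem_univ z' : z' ∈ closure (⋃ n, (𝓑 n : Set B))) (ε / 4) (by positivity)
  obtain ⟨k, hk⟩ := Set.mem_iUnion.1 hy₀
  set n := max m k
  have hcl : IsClosed (𝓑 n : Set B) := (𝓑 n).toSubmodule.closed_of_finiteDimensional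
  set y := conjAverage μ T y₀ with hy
  have hyn : y ∈ 𝓑 n := by
    have := conjAverage_mem μ hT (s := (𝓑 n).restrictScalars ℝ) hcl
      (fun g => hmono (le_max_left _ _) (hTm g)) (hmono (le_max_right m k) hk)
    exact this
  have hyT : ∀ g, Commute y (T g) := commute_conjAverage μ hT y₀
  have hyz' : y ∈ Metric.ball z' ε := by
    rw [mem_ball_iff_norm]
    have h1 := norm_conjAverage_sub_le μ hT hT2 y₀ hz'T
    rw [dist_comm, dist_eq_norm] at hyz
    linarith
  set C : Set B := {x | ∀ g, Commute x (T g)} with hC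
  have hCconv : Convex ℝ C := fun a ha b hb p q _ _ _ g =>
    ((ha g).smul_left p).add_left ((hb g).smul_left q)
  have j1 : JoinedIn {x | IsUnit x ∧ x ∈ C} z' y := by
    refine JoinedIn.mono (U := Metric.ball z' ε ∩ C) ?_ fun x hx => ⟨hball hx.1, hx.2⟩
    exact (((convex_ball z' ε).inter hCconv).isPathConnected
      ⟨z', Metric.mem_ball_self hε, hz'T⟩).joinedIn _ ⟨Metric.mem_ball_self hε, hz'T⟩ _ ⟨hyz', hyT⟩
  have j2 : JoinedIn {x | IsUnit x ∧ x ∈ C} y 1 :=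
    joinedIn_one_of_finite_spectrum (hball hyz')
      (finite_spectrum_of_mem_finiteDimensional hyn) fun c g =>
      (Commute.one_left _).add_left (((hyT g).sub_left (Commute.one_left _)).smul_left c)
  have j3 := (j1.trans j2).map (f := fun x => ↑s * x * ↑s⁻¹) (by fun_prop)
  have e1 : (s : B) * z' * ↑s⁻¹ = z := by simp [hz', mul_assoc]
  have e2 : (s : B) * 1 * ↑s⁻¹ = 1 := by simp
  rw [e1, e2] at j3
  refine j3.mono ?_
  rintro _ ⟨x, ⟨hx, hxT⟩, rfl⟩
  refine ⟨((Units.isUnit _).mul hx).mul (Units.isUnit _), fun g => ?_⟩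
  have h1 : R g = s * T g * ↑s⁻¹ := by rw [← hRs, mul_assoc, Units.mul_inv, mul_one]
  rw [commute_iff_eq, h1]
  simp only [mul_assoc, Units.inv_mul_cancel_left]
  rw [← mul_assoc x, (hxT g).eq, mul_assoc]

end Approximation

section VonNeumann

variable {B : Type*} [CStarAlgebra B]

/-- Two commuting unitaries forming an angle of at most `π / 2` are joined by a segment of
invertible elements. -/
theorem joinedIn_of_nonneg_star_mul_add [PartialOrder B] [StarOrderedRing B] {z v : B}
    (hz : z ∈ unitary B) (hv : v ∈ unitary B) (hzv : Commute z v)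
    (hpos : 0 ≤ star z * v + star v * z) {C : Set B} (hC : Convex ℝ C) (hzC : z ∈ C)
    (hvC : v ∈ C) : JoinedIn {x | IsUnit x ∧ x ∈ C} z v := by
  obtain ⟨z1, z2⟩ := Unitary.mem_iff.1 hz
  obtain ⟨v1, v2⟩ := Unitary.mem_iff.1 hv
  have c1 : v * star z = star z * v := by
    calc v * star z = star z * z * v * star z := by rw [z1, one_mul]
      _ = star z * v := by rw [mul_assoc (star z), hzv.eq, mul_assoc, mul_assoc v, z2, mul_one]
  have c2 : z * star v = star v * z := by
    calc z * star v = star v * v * z * star v := by rw [v1, one_mul]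
      _ = star v * z := by rw [mul_assoc (star v), ← hzv.eq, mul_assoc, mul_assoc z, v2, mul_one]
  refine JoinedIn.ofLine (f := fun t : ℝ => (1 - t) • z + t • v)
    (Continuous.continuousOn (by fun_prop)) (by simp) (by simp) ?_
  rintro _ ⟨t, ⟨ht0, ht1⟩, rfl⟩
  refine ⟨?_, hC hzC hvC (by linarith) ht0 (by ring)⟩
  set x := (1 - t) • z + t • v with hx
  set P := star z * v + star v * z with hP
  have e1 : star x * x = algebraMap ℝ B ((1 - t) ^ 2 + t ^ 2) + (t * (1 - t)) • P := by
    simp only [hx, hP, star_add, star_smul, add_mul, mul_add, smul_mul_smul_comm, star_trivial,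
      z1, v1, Algebra.algebraMap_eq_smul_one, smul_add]
    module
  have e2 : x * star x = algebraMap ℝ B ((1 - t) ^ 2 + t ^ 2) + (t * (1 - t)) • P := by
    simp only [hx, hP, star_add, star_smul, add_mul, mul_add, smul_mul_smul_comm, star_trivial,
      z2, v2, c1, c2, Algebra.algebraMap_eq_smul_one, smul_add]
    module
  have hu : IsUnit (algebraMap ℝ B ((1 - t) ^ 2 + t ^ 2) + (t * (1 - t)) • P) := by
    have hpos' : 0 < (1 - t) ^ 2 + t ^ 2 := by nlinarith
    refine CStarAlgebra.isUnit_of_le (algebraMap ℝ B ((1 - t) ^ 2 + t ^ 2)) ?_ ?_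
    · exact le_add_of_nonneg_right (smul_nonneg (by nlinarith) hpos)
    · exact IsStrictlyPositive.iff_of_unital.2 ⟨algebraMap_nonneg _ hpos'.le,
        (IsUnit.mk0 _ hpos'.ne').map (algebraMap ℝ B)⟩
  rw [isUnit_iff_exists_and_exists]
  exact ⟨⟨star x * Ring.inverse _, by rw [← mul_assoc, e2, Ring.mul_inverse_cancel _ hu]⟩,
    ⟨Ring.inverse _ * star x, by rw [mul_assoc, e1, Ring.inverse_mul_cancel _ hu]⟩⟩

/-- A unitary whose imaginary part has a polar decomposition with a symmetry `w` is joined to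
the unit through invertible elements. -/
theorem joinedIn_one_of_symmetry [PartialOrder B] [StarOrderedRing B] {z w : B}
    (hz : z ∈ unitary B) (hw : IsSelfAdjoint w) (hww : w * w = 1) (hzw : Commute z w)
    (hpos : 0 ≤ w * (imaginaryPart z : B)) {C : Set B} (hC : Convex ℝ C) (hzC : z ∈ C)
    (hwC : Complex.I • w ∈ C) (h1C : (1 : B) ∈ C) : JoinedIn {x | IsUnit x ∧ x ∈ C} z 1 := by
  have hv : Complex.I • w ∈ unitary B := by
    rw [Unitary.mem_iff]
    constructor <;> simp [star_smul, hw.star_eq, smul_smul, hww]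
  have hzw' : star z * w = w * star z := by
    have := congrArg star hzw.eq
    rw [star_mul, star_mul, hw.star_eq] at this
    exact this.symm
  refine (joinedIn_of_nonneg_star_mul_add hz hv (hzw.smul_right _) ?_ hC hzC hwC).trans
    (joinedIn_of_nonneg_star_mul_add hv (one_mem _) (Commute.one_right _) ?_ hC hwC h1C)
  · have : star z * Complex.I • w + star (Complex.I • w) * z
        = (2 : ℝ) • (w * (imaginaryPart z : B)) := by
      rw [imaginaryPart_apply_coe]
      simp only [star_smul, hw.star_eq, mul_smul_comm, smul_mul_assoc, hzw', mul_sub,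
        Complex.star_def, Complex.conj_I]
      module
    rw [this]
    exact smul_nonneg (by norm_num) hpos
  · simp [star_smul, hw.star_eq]

theorem posPart_add_negPart_nonneg [PartialOrder B] [StarOrderedRing B] (b : B) :
    0 ≤ b⁺ + b⁻ :=
  add_nonneg (CFC.posPart_nonneg b) (CFC.negPart_nonneg b)

variable {H : Type*} [NormedAddCommGroup H] [InnerProductSpace ℂ H] [CompleteSpace H]

theorem VonNeumannAlgebra.isClosed (M : VonNeumannAlgebra H) :
    IsClosed (M.toStarSubalgebra : Set (H →L[ℂ] H)) := by
  rw [VonNeumannAlgebra.coe_toStarSubalgebra, ← M.centralizer_centralizer]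
  exact Set.isClosed_centralizer _

/-- The projection onto the kernel of a self-adjoint operator. -/
theorem exists_isStarProjection_of_mul_eq_zero {b c : H →L[ℂ] H}
    (hb : IsSelfAdjoint b) (hbc : b * c = 0) :
    ∃ p : H →L[ℂ] H, IsStarProjection p ∧ p * c = c ∧ p * b = 0 ∧
      ∀ d, Commute d b → Commute (star d) b → Commute d p := by
  set K : Submodule ℂ H := b.ker with hK
  have hKc : IsClosed (K : Set H) := b.isClosed_ker
  have : CompleteSpace K := hKc.completeSpace_coe
  have hp : IsStarProjection K.starProjection := isStarProjection_starProjection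
  have hbp : b * K.starProjection = 0 := by
    ext x
    exact K.starProjection_apply_mem x
  have key : ∀ d, Commute d b → K.starProjection * d * K.starProjection = d * K.starProjection := by
    intro d hd
    ext x
    refine K.starProjection_eq_self_iff.2 ?_
    change b (d (K.starProjection x)) = 0
    have h1 : b (K.starProjection x) = 0 := K.starProjection_apply_mem x
    have h2 : b (d (K.starProjection x)) = d (b (K.starProjection x)) :=
      (DFunLike.congr_fun hd.eq (K.starProjection x)).symm
    rw [h2, h1, map_zero]
  refine ⟨K.starProjection, hp, ?_, ?_, fun d hd hd' => ?_⟩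
  · ext x
    exact K.starProjection_eq_self_iff.2 (DFunLike.congr_fun hbc x)
  · have := congrArg star hbp
    rwa [star_mul, hb.star_eq, hp.isSelfAdjoint.star_eq, star_zero] at this
  · have h1 := key d hd
    have h2 := congrArg star (key _ hd')
    simp only [star_mul, star_star, hp.isSelfAdjoint.star_eq] at h2
    rw [commute_iff_eq, ← h1, mul_assoc]
    exact h2

/-- In a von Neumann algebra, unitaries commuting with a self-adjoint set are joined to the unit
through invertible elements commuting with this set. -/
theorem VonNeumannAlgebra.joinedIn_one (M : VonNeumannAlgebra H)
    [IsClosed (M.toStarSubalgebra : Set (H →L[ℂ] H))]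
    {D : Set M.toStarSubalgebra} (hD : ∀ d ∈ D, star d ∈ D)
    {z : M.toStarSubalgebra} (hz : z ∈ unitary M.toStarSubalgebra) (hzD : ∀ d ∈ D, Commute z d) :
    JoinedIn {x | IsUnit x ∧ ∀ d ∈ D, Commute x d} z 1 := by
  let : PartialOrder M.toStarSubalgebra := CStarAlgebra.spectralOrder _
  have : StarOrderedRing M.toStarSubalgebra := CStarAlgebra.spectralOrderedRing _
  set b : M.toStarSubalgebra := (imaginaryPart z : M.toStarSubalgebra) with hb
  have hbsa : IsSelfAdjoint b := (imaginaryPart z).2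
  have comm_b : ∀ d, Commute d z → Commute d (star z) → Commute d b := by
    intro d h1 h2
    rw [hb, imaginaryPart_apply_coe]
    exact ((h1.sub_right h2).smul_right _).smul_right _
  have hneg : IsSelfAdjoint b⁻ := (CFC.negPart_nonneg b).isSelfAdjoint
  have hnegH : IsSelfAdjoint ((b⁻ : M.toStarSubalgebra) : H →L[ℂ] H) := congrArg Subtype.val hneg
  obtain ⟨p, hp, hp1, hp2, hpc⟩ := exists_isStarProjection_of_mul_eq_zero hnegH
    (c := ((b⁺ : M.toStarSubalgebra) : H →L[ℂ] H))
    (congrArg Subtype.val (CFC.negPart_mul_posPart b))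
  have hpM : p ∈ M := by
    rw [← SetLike.mem_coe, ← M.centralizer_centralizer]
    intro d hd
    refine (hpc d (hd _ (b⁻).2).symm ?_).eq
    have := congrArg star (hd _ (b⁻).2)
    rw [star_mul, star_mul, hnegH.star_eq] at this
    exact this
  set q : M.toStarSubalgebra := ⟨p, hpM⟩ with hq
  have hq1 : q * b⁺ = b⁺ := Subtype.ext hp1
  have hq2 : q * b⁻ = 0 := Subtype.ext hp2
  have hqq : q * q = q := Subtype.ext hp.isIdempotentElem
  have hqsa : IsSelfAdjoint q := Subtype.ext hp.isSelfAdjoint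
  have hqc : ∀ d, Commute d b → Commute (star d) b → Commute d q := by
    intro d h1 h2
    refine Subtype.ext (hpc d ?_ ?_).eq
    · exact congrArg Subtype.val (h1.symm.cfcₙ_real _).symm.eq
    · exact congrArg Subtype.val (h2.symm.cfcₙ_real _).symm.eq
  obtain ⟨z1, z2⟩ := Unitary.mem_iff.1 hz
  have hzz : Commute z (star z) := by rw [commute_iff_eq, z1, z2]
  set w : M.toStarSubalgebra := 2 * q - 1 with hw
  have hwc : ∀ d, Commute d b → Commute (star d) b → Commute w d := fun d h1 h2 =>
    (((Commute.ofNat_left _ _).mul_left (hqc d h1 h2).symm).sub_left (Commute.one_left _))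
  refine joinedIn_one_of_symmetry (w := w) hz ?_ ?_ ?_ ?_ (C := {x | ∀ d ∈ D, Commute x d}) ?_ hzD
    ?_ fun d _ => Commute.one_left _
  · rw [IsSelfAdjoint, hw]
    simp [hqsa.star_eq, two_mul]
  · have : w * w = 4 * (q * q) - 4 * q + 1 := by rw [hw]; noncomm_ring
    rw [this, hqq, sub_self, zero_add]
  · exact (hwc z (comm_b _ (Commute.refl _) hzz) (comm_b _ hzz.symm (Commute.refl _))).symm
  · have : w * b = b⁺ + b⁻ := by
      nth_rw 1 [← CFC.posPart_sub_negPart b hbsa]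
      have : w * (b⁺ - b⁻) = 2 * (q * b⁺) - 2 * (q * b⁻) - b⁺ + b⁻ := by rw [hw]; noncomm_ring
      rw [this, hq1, hq2]
      noncomm_ring
    rw [← hb, this]
    exact posPart_add_negPart_nonneg b
  · exact fun a ha b hb p q _ _ _ d hd => ((ha d hd).smul_left p).add_left ((hb d hd).smul_left q)
  · intro d hd
    have h1 := (hzD d hd).symm
    have h2 := (hzD _ (hD d hd)).symm
    have h3 : Commute d (star z) := by simpa using h2.star_star
    have h4 : Commute (star d) (star z) := h1.star_star
    exact (hwc d (comm_b d h1 h3) (comm_b _ h2 h4)).smul_left _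

end VonNeumann

section Concatenation

variable {X : Type*} [TopologicalSpace X]

/-- Concatenation of the first `n` paths of a sequence, the `k`-th one being run through over
`[k, k + 1]`. -/
noncomputable def concatPath {x : ℕ → X} (p : ∀ n, Path (x n) (x (n + 1))) : ℕ → ℝ → X
  | 0 => fun _ => x 0
  | n + 1 => fun t => if t ≤ n then concatPath p n t else (p n).extend (t - n)

variable {x : ℕ → X} (p : ∀ n, Path (x n) (x (n + 1)))

theorem concatPath_natCast (n : ℕ) : concatPath p n n = x n := by
  cases n with
  | zero => rfl
  | succ n => simp [concatPath]

theorem continuous_concatPath (n : ℕ) : Continuous (concatPath p n) := by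
  induction n with
  | zero => exact continuous_const
  | succ n ih =>
    refine Continuous.if_le ih ((p n).continuous_extend.comp (by fun_prop)) continuous_id
      continuous_const fun t ht => ?_
    rw [ht, concatPath_natCast]
    simp

theorem concatPath_of_le {n m : ℕ} (hnm : n ≤ m) {t : ℝ} (ht : t ≤ n) :
    concatPath p m t = concatPath p n t := by
  induction m, hnm using Nat.le_induction with
  | base => rfl
  | succ m hm ih => exact (if_pos (ht.trans (Nat.cast_le.2 hm))).trans ih

theorem continuous_concatPath_ceil : Continuous fun t : ℝ => concatPath p ⌈t⌉₊ t := by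
  refine continuous_iff_continuousAt.2 fun t => ?_
  refine (continuous_concatPath p (⌊t⌋₊ + 1)).continuousAt.congr ?_
  filter_upwards [gt_mem_nhds (Nat.lt_floor_add_one t)] with s hs
  exact concatPath_of_le p (Nat.ceil_le.2 (by exact_mod_cast hs.le)) (Nat.le_ceil s)

/-- Infinitely many successive paths which shrink to a point `y` can be concatenated to a path
ending at `y`. -/
theorem joinedIn_of_forall_joinedIn_succ {F : Set X} {S : ℕ → Set X} {y : X}
    (hS : ∀ n, S n ⊆ F) (hx : ∀ n, JoinedIn (S n) (x n) (x (n + 1))) (hy : y ∈ F)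
    (hlim : ∀ U ∈ 𝓝 y, ∀ᶠ n in atTop, S n ⊆ U) : JoinedIn F (x 0) y := by
  choose p hp using hx
  set f : ℝ → X := fun t => concatPath p ⌈t⌉₊ t with hf
  have hfS : ∀ N : ℕ, ∀ t : ℝ, N < t → ∃ n ≥ N, f t ∈ S n := by
    intro N t ht
    obtain ⟨n, hn⟩ : ∃ n, ⌈t⌉₊ = n + 1 :=
      Nat.exists_eq_succ_of_ne_zero (Nat.ceil_pos.2 ((Nat.cast_nonneg N).trans_lt ht)).ne'
    have hnt : (n : ℝ) < t := Nat.lt_ceil.1 (by omega)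
    refine ⟨n, ?_, ?_⟩
    · have : N < ⌈t⌉₊ := Nat.lt_ceil.2 ht
      omega
    · simp only [hf, hn, concatPath, if_neg (not_le.2 hnt)]
      obtain ⟨s, hs⟩ : (p n).extend (t - n) ∈ Set.range (p n) := by
        rw [← Path.extend_range]; exact Set.mem_range_self _
      exact hs ▸ hp n s
  have hf0 : f 0 = x 0 := by simp [hf, concatPath]
  refine JoinedIn.ofLine (f := fun s => if s < 1 then f (s / (1 - s)) else y) ?_ (by simp [hf0])
    (if_neg (lt_irrefl _)) ?_
  · rintro s ⟨hs0, hs1⟩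
    rcases hs1.lt_or_eq with hs | rfl
    · refine ContinuousAt.continuousWithinAt ?_
      have : ContinuousAt (fun s : ℝ => f (s / (1 - s))) s :=
        (continuous_concatPath_ceil p).continuousAt.comp
          (continuousAt_id.div (by fun_prop) (sub_ne_zero.2 hs.ne'))
      refine this.congr ?_
      filter_upwards [gt_mem_nhds hs] with r hr
      rw [if_pos hr]
    · intro U hU
      have hU : U ∈ 𝓝 y := by simpa using hU
      obtain ⟨N, hN⟩ := eventually_atTop.1 (hlim U hU)
      have h1 : ∀ᶠ s : ℝ in 𝓝 1, (N : ℝ) * (1 - s) < s := by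
        have hc : Continuous fun s : ℝ => (N : ℝ) * (1 - s) := by fun_prop
        exact (isOpen_lt hc continuous_id).mem_nhds (by simp)
      refine mem_nhdsWithin_of_mem_nhds ?_
      filter_upwards [h1] with s hs
      rw [Set.mem_preimage]
      split_ifs with h
      · obtain ⟨n, hn, hfn⟩ := hfS N (s / (1 - s)) (by rwa [lt_div_iff₀ (by linarith)])
        exact hN n hn hfn
      · exact mem_of_mem_nhds hU
  · rintro _ ⟨s, ⟨hs0, hs1⟩, rfl⟩
    dsimp only
    split_ifs with h
    · rcases hs0.eq_or_lt with rfl | hs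
      · have := hS 0 (hp 0 0)
        simpa [hf0] using this
      · obtain ⟨n, -, hn⟩ := hfS 0 (s / (1 - s)) (by
          rw [Nat.cast_zero]; exact div_pos hs (by linarith))
        exact hS n hn
    · exact hy

end Concatenation

section Unitary

theorem norm_le_one_of_mem_unitary {B : Type*} [CStarAlgebra B] {u : B} (hu : u ∈ unitary B) :
    ‖u‖ ≤ 1 := by
  nontriviality B
  exact (CStarRing.norm_of_mem_unitary hu).le

variable (D : Type*) [CStarAlgebra D]

section

variable [FiniteDimensional ℂ D]

theorem compactSpace_unitary : CompactSpace (unitary D) := by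
  have := FiniteDimensional.proper ℂ D
  refine isCompact_iff_compactSpace.1 (Metric.isCompact_of_isClosed_isBounded isClosed_unitary ?_)
  refine (Metric.isBounded_iff_subset_closedBall 0).2 ⟨1, fun u hu => ?_⟩
  rw [mem_closedBall_zero_iff]
  exact norm_le_one_of_mem_unitary hu

theorem secondCountableTopology_unitary : SecondCountableTopology (unitary D) := by
  have := FiniteDimensional.proper ℂ D
  infer_instance

end

variable {D} {B : Type*} [CStarAlgebra B]

/-- The restriction of a `*`-homomorphism to the unitary group. -/
def StarAlgHom.unitaryRestrict (φ : D →⋆ₐ[ℂ] B) : unitary D →* B :=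
  (φ : D →* B).comp (unitary D).subtype

open scoped CStarAlgebra in
theorem StarAlgHom.continuous_unitaryRestrict (φ : D →⋆ₐ[ℂ] B) :
    Continuous φ.unitaryRestrict :=
  (map_continuous φ).comp continuous_subtype_val

theorem StarAlgHom.norm_unitaryRestrict_le (φ : D →⋆ₐ[ℂ] B) (g : unitary D) :
    ‖φ.unitaryRestrict g‖ ≤ 1 :=
  (NonUnitalStarAlgHom.norm_apply_le φ _).trans (norm_le_one_of_mem_unitary g.2)

theorem StarAlgHom.eq_of_forall_unitary {φ ψ : D →⋆ₐ[ℂ] B} {x y : B}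
    (h : ∀ g ∈ unitary D, φ g * x = y * ψ g) (a : D) : φ a * x = y * ψ a := by
  have ha : a ∈ Submodule.span ℂ (unitary D : Set D) :=
    CStarAlgebra.span_unitary (A := D) ▸ Submodule.mem_top
  induction ha using Submodule.span_induction with
  | mem g hg => exact h g hg
  | zero => simp
  | add a b _ _ ha hb => rw [map_add, map_add, add_mul, mul_add, ha, hb]
  | smul c a _ ha => rw [map_smul, map_smul, smul_mul_assoc, mul_smul_comm, ha]

variable [FiniteDimensional ℂ D]

/-- Two close `*`-homomorphisms on a finite-dimensional algebra are unitarily equivalent. -/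
theorem StarAlgHom.exists_unitary_intertwiner_of_near {φ ψ : D →⋆ₐ[ℂ] B}
    (h : ∀ g ∈ unitary D, ‖ψ g - φ g‖ ≤ 1 / 2) :
    ∃ u ∈ unitary B, ∀ a, φ a * u = u * ψ a := by
  have := compactSpace_unitary D
  have := secondCountableTopology_unitary D
  let : MeasurableSpace (unitary D) := borel _
  have : BorelSpace (unitary D) := ⟨rfl⟩
  let μ : Measure (unitary D) :=
    Measure.haarMeasure (⊤ : TopologicalSpace.PositiveCompacts (unitary D))
  have : IsProbabilityMeasure μ := ⟨Measure.haarMeasure_self⟩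
  obtain ⟨s, hs, hsh⟩ := exists_isUnit_intertwiner_of_near μ
    φ.continuous_unitaryRestrict
    ψ.continuous_unitaryRestrict φ.norm_unitaryRestrict_le (δ := 1 / 2) (by norm_num)
    fun g => h g g.2
  refine ⟨unitaryPart s, unitaryPart_mem_unitary hs, fun a => ?_⟩
  have key : ∀ a, φ a * s = s * ψ a := StarAlgHom.eq_of_forall_unitary fun g hg => hsh ⟨g, hg⟩
  exact mul_unitaryPart_eq (key a) (key (star a)) (map_star φ a).symm (map_star ψ a).symm

theorem StarAlgHom.joinedIn_one_of_isAFAlgebra (hB : IsAFAlgebra B) (φ : D →⋆ₐ[ℂ] B) {z : B}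
    (hz : IsUnit z) (hzφ : ∀ a, Commute z (φ a)) :
    JoinedIn {x | IsUnit x ∧ ∀ a, Commute x (φ a)} z 1 := by
  have := compactSpace_unitary D
  have := secondCountableTopology_unitary D
  let : MeasurableSpace (unitary D) := borel _
  have : BorelSpace (unitary D) := ⟨rfl⟩
  let μ : Measure (unitary D) :=
    Measure.haarMeasure (⊤ : TopologicalSpace.PositiveCompacts (unitary D))
  have : IsProbabilityMeasure μ := ⟨Measure.haarMeasure_self⟩
  refine (_root_.joinedIn_one_of_isAFAlgebra μ hB φ.continuous_unitaryRestrict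
    φ.norm_unitaryRestrict_le hz fun g => hzφ g).mono ?_
  rintro x ⟨hx, hxφ⟩
  exact ⟨hx, fun a => (StarAlgHom.eq_of_forall_unitary (φ := φ) (ψ := φ)
    (fun g hg => (hxφ ⟨g, hg⟩).eq.symm) a).symm⟩

end Unitary

section Orbit

variable {A B : Type*} [CStarAlgebra A] [CStarAlgebra B]

/-- Conjugation of a `*`-homomorphism by a unitary. -/
def StarAlgHom.unitaryConj (ρ : A →⋆ₐ[ℂ] B) (u : unitary B) : A →⋆ₐ[ℂ] B :=
  ((Unitary.conjStarAlgAut ℂ B (star u) : B ≃⋆ₐ[ℂ] B) : B →⋆ₐ[ℂ] B).comp ρ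

theorem StarAlgHom.unitaryConj_apply (ρ : A →⋆ₐ[ℂ] B) (u : unitary B) (a : A) :
    ρ.unitaryConj u a = star (u : B) * ρ a * u := by
  simp [StarAlgHom.unitaryConj, Unitary.conjStarAlgAut_apply]

theorem mem_unitaryOrbit_iff {ρ : A →⋆ₐ[ℂ] B} {f : A → B} :
    f ∈ unitaryOrbit ρ ↔ ∃ u : unitary B, f = ρ.unitaryConj u := by
  constructor
  · rintro ⟨u, hu, rfl⟩
    exact ⟨⟨u, hu⟩, funext fun a => (ρ.unitaryConj_apply ⟨u, hu⟩ a).symm⟩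
  · rintro ⟨u, rfl⟩
    exact ⟨u, u.2, funext fun a => ρ.unitaryConj_apply u a⟩

theorem isClosed_range_starAlgHom :
    IsClosed (Set.range ((↑) : (A →⋆ₐ[ℂ] B) → A → B)) := by
  have h : Set.range ((↑) : (A →⋆ₐ[ℂ] B) → A → B) =
      Set.range ((↑) : (A →ₗ[ℂ] B) → A → B) ∩ Set.range ((↑) : (A →* B) → A → B) ∩
        {f | ∀ a, f (star a) = star (f a)} := by
    ext f
    constructor
    · rintro ⟨φ, rfl⟩
      exact ⟨⟨⟨(φ : A →ₗ[ℂ] B), rfl⟩, ⟨(φ : A →* B), rfl⟩⟩, map_star φ⟩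
    · rintro ⟨⟨⟨l, rfl⟩, ⟨m, hm⟩⟩, hs⟩
      refine ⟨{ AlgHom.ofLinearMap l ?_ ?_ with map_star' := hs }, rfl⟩
      · rw [← hm, map_one]
      · intro a b
        rw [← hm, map_mul]
  rw [h]
  refine ((LinearMap.isClosed_range_coe A B (RingHom.id ℂ)).inter
    (MonoidHom.isClosed_range_coe A B)).inter ?_
  rw [Set.ofPred_forall]
  exact isClosed_iInter fun a => isClosed_eq (by fun_prop) (by fun_prop)

theorem exists_starAlgHom_of_mem_closure_unitaryOrbit {ρ : A →⋆ₐ[ℂ] B} {f : A → B}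
    (hf : f ∈ closure (unitaryOrbit ρ)) : ∃ π : A →⋆ₐ[ℂ] B, ⇑π = f :=
  closure_minimal (fun _ hg => by
    obtain ⟨u, rfl⟩ := mem_unitaryOrbit_iff.1 hg
    exact ⟨_, rfl⟩) isClosed_range_starAlgHom hf

/-- A point in the closure of a unitary orbit is exactly conjugated to the base point on every
finite-dimensional subalgebra. -/
theorem exists_unitaryConj_eqOn {ρ π : A →⋆ₐ[ℂ] B} (h : ⇑π ∈ closure (unitaryOrbit ρ))
    (D : StarSubalgebra ℂ A) [FiniteDimensional ℂ D] :
    ∃ u : unitary B, ∀ a ∈ D, ρ.unitaryConj u a = π a := by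
  have : IsClosed (D : Set A) := D.toSubmodule.closed_of_finiteDimensional
  have := compactSpace_unitary D
  obtain ⟨t, -, htf, htc⟩ := (isCompact_univ (X := unitary D)).elim_finite_subcover_image
    (b := Set.univ) (c := fun g => Metric.ball g (1 / 8)) (fun _ _ => Metric.isOpen_ball)
    (fun g _ => Set.mem_biUnion (Set.mem_univ g) (Metric.mem_ball_self (by norm_num)))
  have hopen : IsOpen {f : A → B | ∀ g ∈ t, ‖f g - π g‖ < 1 / 8} := by
    simp only [Set.ofPred_forall]
    exact htf.isOpen_biInter fun g _ => isOpen_lt (by fun_prop) continuous_const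
  obtain ⟨f, hf, hfρ⟩ := mem_closure_iff.1 h _ hopen (fun g _ => by simp)
  obtain ⟨u₀, rfl⟩ := mem_unitaryOrbit_iff.1 hfρ
  obtain ⟨v, hv, hvD⟩ := StarAlgHom.exists_unitary_intertwiner_of_near
    (φ := (ρ.unitaryConj u₀).comp D.subtype) (ψ := π.comp D.subtype) fun g hg => by
      obtain ⟨k, hk, hkg⟩ := Set.mem_iUnion₂.1 (htc (Set.mem_univ (⟨g, hg⟩ : unitary D)))
      have hgk : ‖(g : A) - (k : D)‖ < 1 / 8 := by
        rw [Metric.mem_ball, Subtype.dist_eq, Subtype.dist_eq, dist_eq_norm] at hkg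
        exact hkg
      have h1 := hf k hk
      have h2 := (NonUnitalStarAlgHom.norm_apply_le π ((g : A) - (k : D))).trans hgk.le
      have h3 := (NonUnitalStarAlgHom.norm_apply_le (ρ.unitaryConj u₀) ((g : A) - (k : D))).trans
        hgk.le
      rw [map_sub] at h2 h3
      have e : π g - ρ.unitaryConj u₀ g = (π g - π (k : D)) - (ρ.unitaryConj u₀ (k : D) - π (k : D))
          - (ρ.unitaryConj u₀ g - ρ.unitaryConj u₀ (k : D)) := by abel
      have h4 := norm_sub_le ((π g - π (k : D)) - (ρ.unitaryConj u₀ (k : D) - π (k : D)))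
        (ρ.unitaryConj u₀ g - ρ.unitaryConj u₀ (k : D))
      have h5 := norm_sub_le (π g - π (k : D)) (ρ.unitaryConj u₀ (k : D) - π (k : D))
      change ‖π g - ρ.unitaryConj u₀ g‖ ≤ 1 / 2
      rw [e]
      linarith
  refine ⟨u₀ * ⟨v, hv⟩, fun a ha => ?_⟩
  have h1 : ρ.unitaryConj u₀ a * v = v * π a := hvD ⟨a, ha⟩
  rw [StarAlgHom.unitaryConj_apply] at h1 ⊢
  rw [Submonoid.coe_mul, star_mul]
  calc star v * star (u₀ : B) * ρ a * (u₀ * v) = star v * (star (u₀ : B) * ρ a * u₀ * v) := by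
        simp only [mul_assoc]
    _ = π a := by rw [h1, ← mul_assoc, (Unitary.mem_iff.1 hv).1, one_mul]

/-- The paths between consecutive members of an approximating sequence. -/
theorem joinedIn_unitaryConj {ρ π : A →⋆ₐ[ℂ] B} {D : Set A} {u v : unitary B}
    (hu : ∀ a ∈ D, ρ.unitaryConj u a = π a) (hv : ∀ a ∈ D, ρ.unitaryConj v a = π a)
    (hconn : ∀ z ∈ unitary B, (∀ a ∈ D, Commute z (ρ a)) →
      JoinedIn {x | IsUnit x ∧ ∀ a ∈ D, Commute x (ρ a)} z 1) (hD : ∀ a ∈ D, star a ∈ D) :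
    JoinedIn {f | f ∈ unitaryOrbit ρ ∧ ∀ a ∈ D, f a = π a} (ρ.unitaryConj u) (ρ.unitaryConj v) := by
  have huu : (u : B) * star (u : B) = 1 := (Unitary.mem_iff.1 u.2).2
  have huu' : star (u : B) * u = 1 := (Unitary.mem_iff.1 u.2).1
  have inter : ∀ {w : unitary B}, ∀ {a}, ρ.unitaryConj w a = π a → ρ a * w = w * π a := by
    intro w a h
    rw [← h, StarAlgHom.unitaryConj_apply, ← mul_assoc, ← mul_assoc, (Unitary.mem_iff.1 w.2).2,
      one_mul]
  have hz : ∀ a ∈ D, Commute ((v * star u : unitary B) : B) (ρ a) := by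
    intro a ha
    have h2 : ρ a = u * π a * star (u : B) := by
      rw [← inter (hu a ha), mul_assoc, huu, mul_one]
    have h3 : star (u : B) * ρ a = π a * star (u : B) := by
      rw [h2, ← mul_assoc, ← mul_assoc, huu', one_mul]
    rw [commute_iff_eq, Submonoid.coe_mul, Unitary.coe_star, mul_assoc, h3, ← mul_assoc,
      ← mul_assoc, inter (hv a ha)]
  have h1 := (hconn _ (v * star u : unitary B).2 hz).symm
  have h2 := h1.map_continuousOn
    (f := fun x a => star (unitaryPart x * u) * ρ a * (unitaryPart x * u)) ?_
  · rw [unitaryPart_of_mem_unitary (one_mem _),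
      unitaryPart_of_mem_unitary (v * star u : unitary B).2] at h2
    have e1 : (fun a => star (1 * (u : B)) * ρ a * (1 * u)) = ρ.unitaryConj u := by
      ext a; rw [one_mul, StarAlgHom.unitaryConj_apply]
    have e2 : (fun a => star (((v * star u : unitary B) : B) * (u : B)) * ρ a *
        (((v * star u : unitary B) : B) * u)) = ρ.unitaryConj v := by
      ext a
      rw [Submonoid.coe_mul, Unitary.coe_star, mul_assoc (v : B), huu', mul_one,
        StarAlgHom.unitaryConj_apply]
    rw [e1, e2] at h2
    refine h2.mono ?_
    rintro _ ⟨x, ⟨hx, hxD⟩, rfl⟩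
    have hxu := unitaryPart_mem_unitary hx
    refine ⟨⟨_, mul_mem hxu u.2, rfl⟩, fun a ha => ?_⟩
    have hc : ρ a * unitaryPart x = unitaryPart x * ρ a :=
      mul_unitaryPart_eq (hxD a ha).eq.symm (hxD _ (hD a ha)).eq.symm (map_star ρ a).symm
        (map_star ρ a).symm
    change star (unitaryPart x * u) * ρ a * (unitaryPart x * u) = π a
    rw [← hu a ha, StarAlgHom.unitaryConj_apply, star_mul, ← mul_assoc, mul_assoc _ (ρ a), hc,
      mul_assoc (star (u : B)), ← mul_assoc (star (unitaryPart x)), (Unitary.mem_iff.1 hxu).1,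
      one_mul]
  · have hc : ContinuousOn unitaryPart {x : B | IsUnit x ∧ ∀ a ∈ D, Commute x (ρ a)} :=
      continuousOn_unitaryPart.mono fun x hx => hx.1
    exact continuousOn_pi.2 fun a => by fun_prop

/-- The closure of a unitary orbit is path-connected as soon as the unitaries in relative
commutants of finite-dimensional subalgebras are connected to the unit. -/
theorem isPathConnected_closure_unitaryOrbit (hA : IsAFAlgebra A) (ρ : A →⋆ₐ[ℂ] B)
    (hconn : ∀ D : StarSubalgebra ℂ A, FiniteDimensional ℂ D → ∀ z ∈ unitary B,
      (∀ a ∈ D, Commute z (ρ a)) → JoinedIn {x | IsUnit x ∧ ∀ a ∈ D, Commute x (ρ a)} z 1) :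
    IsPathConnected (closure (unitaryOrbit ρ)) := by
  obtain ⟨𝒜, hmono, hfin, hdense⟩ := hA
  have hρ : ⇑ρ ∈ unitaryOrbit ρ := ⟨1, one_mem _, by simp⟩
  refine ⟨ρ, subset_closure hρ, fun {f} hf => ?_⟩
  obtain ⟨π, rfl⟩ := exists_starAlgHom_of_mem_closure_unitaryOrbit hf
  choose u hu using fun n => have := hfin n; exists_unitaryConj_eqOn hf (𝒜 n)
  have hρ1 : ρ.unitaryConj 1 = ρ := by
    ext a; simp [StarAlgHom.unitaryConj_apply]
  have hbot : FiniteDimensional ℂ (⊥ : StarSubalgebra ℂ A) := by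
    change FiniteDimensional ℂ (⊥ : StarSubalgebra ℂ A).toSubalgebra
    rw [StarSubalgebra.bot_toSubalgebra]
    exact Subalgebra.finite_bot
  have hbotπ : ∀ φ : A →⋆ₐ[ℂ] B, ∀ a ∈ (⊥ : StarSubalgebra ℂ A), φ a = π a := by
    rintro φ a ha
    obtain ⟨c, rfl⟩ := StarSubalgebra.mem_bot.1 ha
    rw [AlgHomClass.commutes φ, AlgHomClass.commutes π]
  have h0 : JoinedIn (closure (unitaryOrbit ρ)) ρ (ρ.unitaryConj (u 0)) := by
    have := joinedIn_unitaryConj (D := (⊥ : StarSubalgebra ℂ A)) (u := 1) (v := u 0)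
      (hbotπ (ρ.unitaryConj 1)) (hbotπ _) (hconn _ hbot)
      fun a (ha : a ∈ (⊥ : StarSubalgebra ℂ A)) => star_mem ha
    rw [hρ1] at this
    exact this.mono fun g hg => subset_closure hg.1
  refine h0.trans (joinedIn_of_forall_joinedIn_succ (x := fun n => ⇑(ρ.unitaryConj (u n)))
    (S := fun n => {g | g ∈ unitaryOrbit ρ ∧ ∀ a ∈ 𝒜 n, g a = π a})
    (fun n g hg => subset_closure hg.1)
    (fun n => joinedIn_unitaryConj (hu n) (fun a ha => hu (n + 1) a (hmono n.le_succ ha))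
      (hconn _ (hfin n)) fun a ha => star_mem ha) hf fun U hU => ?_)
  rw [nhds_pi, Filter.mem_pi] at hU
  obtain ⟨I, hI, t, ht, htU⟩ := hU
  have key : ∀ a ∈ I, ∀ᶠ n in atTop, ∀ g ∈ unitaryOrbit ρ, (∀ b ∈ 𝒜 n, g b = π b) → g a ∈ t a := by
    intro a _
    obtain ⟨ε, hε, hεt⟩ := Metric.mem_nhds_iff.1 (ht a)
    obtain ⟨b, hb, hab⟩ := Metric.mem_closure_iff.1 (hdense ▸ Set.mem_univ a) (ε / 2)
      (by positivity)
    obtain ⟨k, hk⟩ := Set.mem_iUnion.1 hb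
    filter_upwards [eventually_ge_atTop k] with n hn g hg hgπ
    obtain ⟨v, rfl⟩ := mem_unitaryOrbit_iff.1 hg
    refine hεt ?_
    rw [dist_eq_norm] at hab
    have h1 := NonUnitalStarAlgHom.norm_apply_le (ρ.unitaryConj v) (a - b)
    have h2 := NonUnitalStarAlgHom.norm_apply_le π (a - b)
    rw [map_sub] at h1 h2
    have h3 := hgπ b (hmono hn hk)
    have h4 := norm_sub_le (ρ.unitaryConj v a - ρ.unitaryConj v b) (π a - π b)
    rw [h3, sub_sub_sub_cancel_right] at h4
    rw [h3] at h1
    rw [mem_ball_iff_norm]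
    linarith
  filter_upwards [(hI.eventually_all).2 key] with n hn g hg
  exact htU fun a ha => hn a ha g hg.1 hg.2

theorem isPathConnected_closure_unitaryOrbit_of_isAFAlgebra (hA : IsAFAlgebra A)
    (hB : IsAFAlgebra B) (ρ : A →⋆ₐ[ℂ] B) : IsPathConnected (closure (unitaryOrbit ρ)) := by
  refine isPathConnected_closure_unitaryOrbit hA ρ fun D hD z hz hzD => ?_
  have : IsClosed (D : Set A) := D.toSubmodule.closed_of_finiteDimensional
  refine ((ρ.comp D.subtype).joinedIn_one_of_isAFAlgebra hB
    (Unitary.toUnits ⟨z, hz⟩).isUnit fun a => hzD a a.2).mono ?_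
  exact fun x hx => ⟨hx.1, fun a ha => hx.2 ⟨a, ha⟩⟩

theorem isPathConnected_closure_unitaryOrbitVN {H : Type*} [NormedAddCommGroup H]
    [InnerProductSpace ℂ H] [CompleteSpace H] (M : VonNeumannAlgebra H) (hA : IsAFAlgebra A)
    (ρ : A →⋆ₐ[ℂ] (H →L[ℂ] H)) (hρ : ∀ a, ρ a ∈ M) :
    IsPathConnected (closure (unitaryOrbitVN M ρ)) := by
  have hM : IsClosed (M.toStarSubalgebra : Set (H →L[ℂ] H)) := M.isClosed
  set ρM : A →⋆ₐ[ℂ] M.toStarSubalgebra := ρ.codRestrict M.toStarSubalgebra hρ with hρM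
  have h1 : IsPathConnected (closure (unitaryOrbit ρM)) := by
    refine isPathConnected_closure_unitaryOrbit hA ρM fun D hD z hz hzD => ?_
    refine (M.joinedIn_one (D := ρM '' D) ?_ hz ?_).mono fun x hx =>
      ⟨hx.1, fun a ha => hx.2 _ ⟨a, ha, rfl⟩⟩
    · rintro _ ⟨a, ha, rfl⟩
      exact ⟨star a, star_mem ha, map_star ρM a⟩
    · rintro _ ⟨a, ha, rfl⟩
      exact hzD a ha
  have hemb : IsClosedEmbedding
      (fun f : A → M.toStarSubalgebra => fun a => (f a : H →L[ℂ] H)) := by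
    refine ⟨IsEmbedding.piMap fun _ => IsEmbedding.subtypeVal, ?_⟩
    have : Set.range (fun f : A → M.toStarSubalgebra => fun a => (f a : H →L[ℂ] H)) =
        Set.univ.pi fun _ => (M.toStarSubalgebra : Set (H →L[ℂ] H)) := by
      ext f
      constructor
      · rintro ⟨g, rfl⟩ a -
        exact (g a).2
      · exact fun hf => ⟨fun a => ⟨f a, hf a trivial⟩, rfl⟩
    rw [this]
    exact isClosed_set_pi fun _ _ => hM
  have himg : unitaryOrbitVN M ρ =
      (fun f : A → M.toStarSubalgebra => fun a => (f a : H →L[ℂ] H)) '' unitaryOrbit ρM := by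
    ext f
    constructor
    · rintro ⟨u, huM, hu, rfl⟩
      exact ⟨_, ⟨⟨u, huM⟩, ⟨Subtype.ext hu.1, Subtype.ext hu.2⟩, rfl⟩, rfl⟩
    · rintro ⟨_, ⟨u, hu, rfl⟩, rfl⟩
      exact ⟨u, u.2, ⟨congrArg Subtype.val hu.1, congrArg Subtype.val hu.2⟩, rfl⟩
  rw [himg, hemb.closure_image_eq]
  exact h1.image hemb.continuous

end Orbit

theorem stmt11 :
    (∀ (A : Type*) [CStarAlgebra A] [TopologicalSpace.SeparableSpace A]
      (B : Type*) [CStarAlgebra B], IsAFAlgebra A → IsAFAlgebra B →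
      ∀ ρ : A →⋆ₐ[ℂ] B, IsPathConnected (closure (unitaryOrbit ρ))) ∧
    (∀ (A : Type*) [CStarAlgebra A] [TopologicalSpace.SeparableSpace A]
      (H : Type*) [NormedAddCommGroup H] [InnerProductSpace ℂ H] [CompleteSpace H]
      (M : VonNeumannAlgebra H), IsAFAlgebra A →
      ∀ ρ : A →⋆ₐ[ℂ] (H →L[ℂ] H), (∀ a, ρ a ∈ M) →
        IsPathConnected (closure (unitaryOrbitVN M ρ))) :=
  ⟨fun _ _ _ _ _ hA hB ρ => isPathConnected_closure_unitaryOrbit_of_isAFAlgebra hA hB ρ,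
    fun _ _ _ _ _ _ _ M hA ρ hρ => isPathConnected_closure_unitaryOrbitVN M hA ρ hρ⟩
end

section
/- Suppose N is a von Neumann algebra on a complex Hilbert space H that is countably generated (i.e., generated as a von Neumann algebra by a countable subset). Then there exists an orthogonal family (p_i)_{i∈I} of central projections of N with supremum 1 such that for each i ∈ I there is a separable closed subspace K_i ⊆ p_i(H), invariant under N, for which the compression map N p_i → B(K_i), x p_i ↦ (x p_i)|_{K_i}, is injective (hence a *-isomorphism onto its image). In particular, each direct summand N p_i is isomorphic to a von Neumann algebra acting on a separable Hilbert space, and is σ-finite. -/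
open scoped InnerProductSpace

section CyclicSubspace

variable {H : Type*} [NormedAddCommGroup H] [InnerProductSpace ℂ H]

/-- The smallest closed subspace containing `ξ` and invariant under `M`. -/
def cyclicSubspace (M : Set (H →L[ℂ] H)) (ξ : H) : Submodule ℂ H :=
  (Submodule.span ℂ ((fun w : H →L[ℂ] H => w ξ) '' Submonoid.closure M)).topologicalClosure

theorem isClosed_cyclicSubspace (M : Set (H →L[ℂ] H)) (ξ : H) :
    IsClosed (cyclicSubspace M ξ : Set H) :=
  Submodule.isClosed_topologicalClosure _

instance [CompleteSpace H] (M : Set (H →L[ℂ] H)) (ξ : H) :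
    (cyclicSubspace M ξ).HasOrthogonalProjection :=
  have : CompleteSpace (cyclicSubspace M ξ) := (isClosed_cyclicSubspace M ξ).completeSpace_coe
  inferInstance

theorem apply_mem_cyclicSubspace_of_mem_closure {M : Set (H →L[ℂ] H)} {w : H →L[ℂ] H}
    (hw : w ∈ Submonoid.closure M) (ξ : H) : w ξ ∈ cyclicSubspace M ξ :=
  Submodule.le_topologicalClosure _ (Submodule.subset_span ⟨w, hw, rfl⟩)

theorem mem_cyclicSubspace_self (M : Set (H →L[ℂ] H)) (ξ : H) : ξ ∈ cyclicSubspace M ξ :=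
  apply_mem_cyclicSubspace_of_mem_closure (one_mem (Submonoid.closure M)) ξ

theorem cyclicSubspace_le_of_forall_apply_mem {M : Set (H →L[ℂ] H)} {ξ : H}
    {Z : Submodule ℂ H} (hZ : IsClosed (Z : Set H))
    (h : ∀ w ∈ Submonoid.closure M, w ξ ∈ Z) : cyclicSubspace M ξ ≤ Z := by
  refine Submodule.topologicalClosure_minimal _ (Submodule.span_le.2 ?_) hZ
  rintro _ ⟨w, hw, rfl⟩
  exact h w hw

theorem cyclicSubspace_le {M : Set (H →L[ℂ] H)} {ξ : H} {Z : Submodule ℂ H}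
    (hZ : IsClosed (Z : Set H)) (hξ : ξ ∈ Z) (hM : ∀ T ∈ M, ∀ x ∈ Z, T x ∈ Z) :
    cyclicSubspace M ξ ≤ Z := by
  refine cyclicSubspace_le_of_forall_apply_mem hZ fun w hw => ?_
  suffices ∀ x ∈ Z, w x ∈ Z from this ξ hξ
  induction hw using Submonoid.closure_induction with
  | mem T hT => exact hM T hT
  | one => exact fun x hx => hx
  | mul a b _ _ ha hb => exact fun x hx => ha _ (hb x hx)

theorem apply_mem_cyclicSubspace {M : Set (H →L[ℂ] H)} {T : H →L[ℂ] H} (hT : T ∈ M) {ξ x : H}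
    (hx : x ∈ cyclicSubspace M ξ) : T x ∈ cyclicSubspace M ξ := by
  suffices cyclicSubspace M ξ ≤ (cyclicSubspace M ξ).comap (T : H →ₗ[ℂ] H) from this hx
  refine cyclicSubspace_le_of_forall_apply_mem
    ((isClosed_cyclicSubspace M ξ).preimage T.continuous) fun w hw => ?_
  exact apply_mem_cyclicSubspace_of_mem_closure
    (mul_mem (Submonoid.subset_closure hT) hw) ξ

theorem cyclicSubspace_mono {M L : Set (H →L[ℂ] H)} (h : M ⊆ L) (ξ : H) :
    cyclicSubspace M ξ ≤ cyclicSubspace L ξ :=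
  cyclicSubspace_le (isClosed_cyclicSubspace L ξ) (mem_cyclicSubspace_self L ξ)
    fun _ hT _ hx => apply_mem_cyclicSubspace (h hT) hx

theorem Submonoid.countable_closure {G : Type*} [Monoid G] {s : Set G} (hs : s.Countable) :
    (Submonoid.closure s : Set G).Countable := by
  have := hs.to_subtype
  refine (Set.countable_range fun l : List s => (l.map Subtype.val).prod).mono fun x hx => ?_
  obtain ⟨l, hl, rfl⟩ := Submonoid.exists_list_of_mem_closure hx
  exact ⟨l.attachWith (· ∈ s) hl, by simp⟩

theorem separableSpace_cyclicSubspace {M : Set (H →L[ℂ] H)} (hM : M.Countable) (ξ : H) :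
    TopologicalSpace.SeparableSpace (cyclicSubspace M ξ) := by
  refine TopologicalSpace.IsSeparable.separableSpace (s := (cyclicSubspace M ξ : Set H)) ?_
  rw [cyclicSubspace, Submodule.topologicalClosure_coe]
  exact (((Submonoid.countable_closure hM).image _).isSeparable.span (R := ℂ)).closure

variable [CompleteSpace H]

theorem starProjection_apply_comm {U : Submodule ℂ H} [U.HasOrthogonalProjection]
    {T : H →L[ℂ] H} (hT : ∀ x ∈ U, T x ∈ U) (hT' : ∀ x ∈ U, star T x ∈ U) :
    T * U.starProjection = U.starProjection * T := by
  ext x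
  refine (Submodule.eq_starProjection_of_mem_orthogonal
    (hT _ (Submodule.starProjection_apply_mem U x)) ?_).symm
  rw [ContinuousLinearMap.coe_coe, ← map_sub, Submodule.mem_orthogonal]
  intro u hu
  rw [← ContinuousLinearMap.adjoint_inner_left]
  exact Submodule.inner_right_of_mem_orthogonal (hT' u hu)
    (Submodule.sub_starProjection_mem_orthogonal x)

theorem mul_starProjection_cyclicSubspace {M : Set (H →L[ℂ] H)} (hM : ∀ T ∈ M, star T ∈ M)
    (ξ : H) {T : H →L[ℂ] H} (hT : T ∈ M) :
    T * (cyclicSubspace M ξ).starProjection = (cyclicSubspace M ξ).starProjection * T :=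
  starProjection_apply_comm (fun _ hx => apply_mem_cyclicSubspace hT hx)
    fun _ hx => apply_mem_cyclicSubspace (hM T hT) hx

theorem cyclicSubspace_isOrtho {M : Set (H →L[ℂ] H)} (hM : ∀ T ∈ M, star T ∈ M) {ξ η : H}
    (h : η ∈ (cyclicSubspace M ξ)ᗮ) : cyclicSubspace M η ≤ (cyclicSubspace M ξ)ᗮ := by
  refine cyclicSubspace_le (Submodule.isClosed_orthogonal _) h fun T hT x hx => ?_
  rw [Submodule.mem_orthogonal] at hx ⊢
  intro u hu
  rw [← ContinuousLinearMap.adjoint_inner_left]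
  exact hx _ (apply_mem_cyclicSubspace (hM T hT) hu)

/-- If `ξ` and `η` induce the same vector functional and have orthogonal cyclic subspaces, then the
projection onto the cyclic subspace of `ξ + η` maps `2 • ξ` to `ξ + η`. -/
theorem starProjection_cyclicSubspace_add {M : Set (H →L[ℂ] H)} {ξ η : H}
    (hξη : cyclicSubspace M ξ ⟂ cyclicSubspace M η)
    (h : ∀ w ∈ Submonoid.closure M, ⟪ξ, w ξ⟫_ℂ = ⟪η, w η⟫_ℂ) :
    (cyclicSubspace M (ξ + η)).starProjection ((2 : ℂ) • ξ) = ξ + η := by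
  refine Submodule.eq_starProjection_of_mem_orthogonal (mem_cyclicSubspace_self M _) ?_
  have hle : cyclicSubspace M (ξ + η) ≤ (ℂ ∙ (ξ - η))ᗮ := by
    refine cyclicSubspace_le_of_forall_apply_mem (Submodule.isClosed_orthogonal _) fun w hw => ?_
    rw [Submodule.mem_orthogonal_singleton_iff_inner_right]
    have h₁ : ⟪ξ, w η⟫_ℂ = 0 := Submodule.isOrtho_iff_inner_eq.1 hξη _
      (mem_cyclicSubspace_self M ξ) _ (apply_mem_cyclicSubspace_of_mem_closure hw η)
    have h₂ : ⟪η, w ξ⟫_ℂ = 0 := Submodule.isOrtho_iff_inner_eq.1 hξη.symm _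
      (mem_cyclicSubspace_self M η) _ (apply_mem_cyclicSubspace_of_mem_closure hw ξ)
    simp [inner_sub_left, inner_add_right, h₁, h₂, h w hw]
  have hmem : (2 : ℂ) • ξ - (ξ + η) = ξ - η := by rw [two_smul]; abel
  rw [hmem, Submodule.mem_orthogonal']
  intro u hu
  exact Submodule.mem_orthogonal_singleton_iff_inner_right.1 (hle hu)

end CyclicSubspace

section Countability

variable {H : Type*} [NormedAddCommGroup H] [InnerProductSpace ℂ H] [CompleteSpace H]

theorem countable_of_pairwise_mul_eq_zero {K : Submodule ℂ H} [TopologicalSpace.SeparableSpace K]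
    {P : Set (H →L[ℂ] H)} (hP : ∀ q ∈ P, IsStarProjection q)
    (hK : ∀ q ∈ P, ∃ x ∈ K, q x ∈ K ∧ q x ≠ 0)
    (horth : ∀ q ∈ P, ∀ r ∈ P, q ≠ r → q * r = 0) : P.Countable := by
  let U : (H →L[ℂ] H) → Set K := fun q => {x | ‖(x : H) - q x‖ < ‖q x‖}
  refine Set.PairwiseDisjoint.countable_of_isOpen (s := U) ?_ ?_ ?_
  · have key : ∀ q ∈ P, ∀ r ∈ P, q ≠ r → ∀ x : H, ‖r x‖ ≤ ‖x - q x‖ := by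
      intro q hq r hr hqr x
      have hrq : r (q x) = 0 := congr($(horth r hr q hq hqr.symm) x)
      calc ‖r x‖ = ‖r (x - q x)‖ := by rw [map_sub, hrq, sub_zero]
        _ ≤ ‖r‖ * ‖x - q x‖ := r.le_opNorm _
        _ ≤ ‖x - q x‖ := mul_le_of_le_one_left (norm_nonneg _) (hP r hr).norm_le
    intro q hq r hr hqr
    refine Set.disjoint_left.2 fun x hxq hxr => ?_
    rw [Set.mem_ofPred_eq] at hxq hxr
    have h₁ := key q hq r hr hqr x
    have h₂ := key r hr q hq hqr.symm x
    linarith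
  · intro q _
    exact isOpen_lt (by fun_prop) (by fun_prop)
  · intro q hq
    obtain ⟨x, -, hqx, hne⟩ := hK q hq
    have hqq : q (q x) = q x := congr($((hP q hq).isIdempotentElem) x)
    refine ⟨⟨q x, hqx⟩, ?_⟩
    simpa [U, hqq] using hne

end Countability

namespace VonNeumannAlgebra

variable {H : Type*} [NormedAddCommGroup H] [InnerProductSpace ℂ H] [CompleteSpace H]

theorem commutes_of_generates {N : VonNeumannAlgebra H} {S : Set (H →L[ℂ] H)}
    (hgen : ∀ T : VonNeumannAlgebra H, S ⊆ (T : Set (H →L[ℂ] H)) →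
      (N : Set (H →L[ℂ] H)) ⊆ (T : Set (H →L[ℂ] H)))
    {y : H →L[ℂ] H} (hy : ∀ s ∈ S ∪ star S, s * y = y * s) {x : H →L[ℂ] H} (hx : x ∈ N) :
    x * y = y * x := by
  let C : VonNeumannAlgebra H :=
    { toStarSubalgebra := StarSubalgebra.centralizer ℂ
        (StarSubalgebra.centralizer ℂ S : Set (H →L[ℂ] H))
      centralizer_centralizer' := by simp }
  have hyC : y ∈ StarSubalgebra.centralizer ℂ S := by
    rw [StarSubalgebra.mem_centralizer_iff]
    exact fun s hs => ⟨hy s (.inl hs), hy _ (.inr (by simpa using hs))⟩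
  have hxC : x ∈ StarSubalgebra.centralizer ℂ
      (StarSubalgebra.centralizer ℂ S : Set (H →L[ℂ] H)) := by
    refine hgen C (fun s hs => ?_) hx
    change s ∈ StarSubalgebra.centralizer ℂ _
    rw [StarSubalgebra.mem_centralizer_iff]
    intro g hg
    have hg' := star_mem hg
    rw [SetLike.mem_coe] at hg
    rw [StarSubalgebra.mem_centralizer_iff] at hg hg'
    exact ⟨(hg s hs).1.symm, (hg' s hs).1.symm⟩
  rw [StarSubalgebra.mem_centralizer_iff] at hxC
  exact (hxC y hyC).1.symm

/-- The union of an algebra and its commutant. -/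
def withCommutant (N : VonNeumannAlgebra H) : Set (H →L[ℂ] H) := N ∪ N.commutant

theorem star_mem_withCommutant (N : VonNeumannAlgebra H) :
    ∀ T ∈ N.withCommutant, star T ∈ N.withCommutant :=
  fun _ hT => hT.imp (fun h => star_mem (S := VonNeumannAlgebra H) h)
    (fun h => star_mem (S := VonNeumannAlgebra H) h)

/-- The projection onto the smallest closed subspace containing `ξ` that is invariant under `N` and
its commutant. -/
noncomputable def centralProjection (N : VonNeumannAlgebra H) (ξ : H) : H →L[ℂ] H :=
  (cyclicSubspace N.withCommutant ξ).starProjection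

theorem mul_centralProjection (N : VonNeumannAlgebra H) (ξ : H) {x : H →L[ℂ] H} (hx : x ∈ N) :
    x * N.centralProjection ξ = N.centralProjection ξ * x :=
  mul_starProjection_cyclicSubspace N.star_mem_withCommutant ξ (.inl hx)

theorem commutant_mul_centralProjection (N : VonNeumannAlgebra H) (ξ : H) {x : H →L[ℂ] H}
    (hx : x ∈ N.commutant) : x * N.centralProjection ξ = N.centralProjection ξ * x :=
  mul_starProjection_cyclicSubspace N.star_mem_withCommutant ξ (.inr hx)

theorem centralProjection_mem (N : VonNeumannAlgebra H) (ξ : H) : N.centralProjection ξ ∈ N := by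
  have h : N.centralProjection ξ ∈ N.commutant.commutant :=
    mem_commutant_iff.2 fun g hg => N.commutant_mul_centralProjection ξ hg
  rwa [N.commutant_commutant] at h

theorem isStarProjection_centralProjection (N : VonNeumannAlgebra H) (ξ : H) :
    IsStarProjection (N.centralProjection ξ) :=
  isStarProjection_starProjection

/-- An element of `N` vanishing on the orbit of `ξ` under `N` vanishes on the range of
`N.centralProjection ξ`. -/
theorem mul_centralProjection_eq_zero {N : VonNeumannAlgebra H} {ξ : H} {T : H →L[ℂ] H}
    (hT : T ∈ N) (h : ∀ a ∈ N, T (a ξ) = 0) : T * N.centralProjection ξ = 0 := by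
  let Z : Submodule ℂ H := ⨅ a : N, (T * (a : H →L[ℂ] H)).ker
  have hZ : ∀ v, v ∈ Z ↔ ∀ a ∈ N, T (a v) = 0 := by simp [Z, Submodule.mem_iInf]
  have hZc : IsClosed (Z : Set H) := by
    simp only [Z, Submodule.coe_iInf]
    exact isClosed_iInter fun a => ContinuousLinearMap.isClosed_ker _
  have hle : cyclicSubspace N.withCommutant ξ ≤ Z := by
    refine cyclicSubspace_le hZc ((hZ ξ).2 h) fun b hb v hv => ?_
    rw [hZ] at hv ⊢
    intro a ha
    rcases hb with hb | hb
    · exact hv (a * b) (mul_mem ha hb)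
    · have hab : T * a * b = b * (T * a) := mem_commutant_iff.1 hb _ (mul_mem hT ha)
      exact congr($hab v).trans ((congrArg b (hv a ha)).trans (map_zero b))
  ext x
  exact (hZ _).1 (hle (Submodule.starProjection_apply_mem _ x)) 1 (one_mem N)

theorem exists_maximal_orthogonal_vectors (N : VonNeumannAlgebra H) :
    ∃ X : Set H, (∀ ξ ∈ X, ξ ≠ 0) ∧
      (X.Pairwise fun ξ η => cyclicSubspace N.withCommutant ξ ⟂ cyclicSubspace N.withCommutant η) ∧
      ∀ x, (∀ ξ ∈ X, N.centralProjection ξ x = 0) → x = 0 := by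
  let F : Set (Set H) := {X | (∀ ξ ∈ X, ξ ≠ 0) ∧
    X.Pairwise fun ξ η => cyclicSubspace N.withCommutant ξ ⟂ cyclicSubspace N.withCommutant η}
  obtain ⟨X, hX⟩ : ∃ X, Maximal (· ∈ F) X := by
    refine zorn_subset F fun c hc hchain =>
      ⟨⋃₀ c, ⟨?_, ?_⟩, fun s hs => Set.subset_sUnion_of_mem hs⟩
    · rintro ξ ⟨s, hs, hξ⟩
      exact (hc hs).1 ξ hξ
    · exact (Set.pairwise_sUnion hchain.directedOn).2 fun s hs => (hc hs).2
  refine ⟨X, hX.prop.1, hX.prop.2, fun x hx => by_contra fun hx0 => ?_⟩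
  have hperp : ∀ ξ ∈ X, cyclicSubspace N.withCommutant x ⟂ cyclicSubspace N.withCommutant ξ :=
    fun ξ hξ => cyclicSubspace_isOrtho N.star_mem_withCommutant
      ((Submodule.starProjection_apply_eq_zero_iff _).1 (hx ξ hξ))
  have hins : insert x X ∈ F := by
    refine ⟨?_, hX.prop.2.insert fun ξ hξ _ => ⟨hperp ξ hξ, (hperp ξ hξ).symm⟩⟩
    rintro ξ (rfl | hξ)
    exacts [hx0, hX.prop.1 ξ hξ]
  have hxX : x ∈ X := hX.le_of_ge hins (Set.subset_insert x X) (Set.mem_insert x X)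
  have hself := hperp x hxX
  have hxm := mem_cyclicSubspace_self N.withCommutant x
  exact hx0 (inner_self_eq_zero.1 (Submodule.isOrtho_iff_inner_eq.1 hself x hxm x hxm))

/-- Vectors with orthogonal `centralProjection` are told apart by their vector functionals on any
set with the same commutant as `N`. -/
theorem eq_of_inner_apply_eq {N : VonNeumannAlgebra H} {M : Set (H →L[ℂ] H)}
    (hM : ∀ T ∈ M, star T ∈ M) (hMN : M ⊆ N)
    (hcomm : ∀ y : H →L[ℂ] H, (∀ s ∈ M, s * y = y * s) → y ∈ N.commutant) {ξ η : H}
    (horth : cyclicSubspace N.withCommutant ξ ⟂ cyclicSubspace N.withCommutant η)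
    (h : ∀ w ∈ Submonoid.closure M, ⟪ξ, w ξ⟫_ℂ = ⟪η, w η⟫_ℂ) : η = 0 := by
  have hML : M ⊆ N.withCommutant := hMN.trans Set.subset_union_left
  have hg := starProjection_cyclicSubspace_add
    (horth.mono (cyclicSubspace_mono hML ξ) (cyclicSubspace_mono hML η)) h
  have hgN : (cyclicSubspace M (ξ + η)).starProjection ∈ N.withCommutant :=
    .inr (hcomm _ fun s hs => mul_starProjection_cyclicSubspace hM _ hs)
  have hξ := mem_cyclicSubspace_self N.withCommutant ξ
  have hmem : ξ + η ∈ cyclicSubspace N.withCommutant ξ :=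
    hg ▸ apply_mem_cyclicSubspace hgN (Submodule.smul_mem _ _ hξ)
  have hη : η ∈ cyclicSubspace N.withCommutant ξ := by
    simpa using Submodule.sub_mem _ hmem hξ
  exact inner_self_eq_zero.1 (Submodule.isOrtho_iff_inner_eq.1 horth η hη η
    (mem_cyclicSubspace_self _ η))

end VonNeumannAlgebra

open VonNeumannAlgebra


theorem stmt12 (H : Type*) [NormedAddCommGroup H] [InnerProductSpace ℂ H] [CompleteSpace H]
    (N : VonNeumannAlgebra H)
    (hgen : ∃ S : Set (H →L[ℂ] H), S.Countable ∧ S ⊆ (N : Set (H →L[ℂ] H)) ∧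
      ∀ T : VonNeumannAlgebra H, S ⊆ (T : Set (H →L[ℂ] H)) →
        (N : Set (H →L[ℂ] H)) ⊆ (T : Set (H →L[ℂ] H))) :
    ∃ (I : Type) (p : I → (H →L[ℂ] H)) (K : I → Submodule ℂ H),
      -- the `p i` are projections in `N`
      (∀ i, p i ∈ N) ∧ (∀ i, IsSelfAdjoint (p i)) ∧ (∀ i, p i * p i = p i) ∧
      -- central
      (∀ i, ∀ x ∈ N, x * p i = p i * x) ∧
      -- mutually orthogonal
      (∀ i j, i ≠ j → p i * p j = 0) ∧
      -- with supremum `1`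
      (∀ x : H, (∀ i, p i x = 0) → x = 0) ∧
      -- each `K i` is a separable closed subspace of `p i (H)`, invariant under `N`
      (∀ i, IsClosed (K i : Set H)) ∧
      (∀ i, TopologicalSpace.SeparableSpace (K i)) ∧
      (∀ i, ∀ x ∈ K i, p i x = x) ∧
      (∀ i, ∀ T ∈ N, ∀ x ∈ K i, T x ∈ K i) ∧
      -- the compression `N p i → B(K i)` is injective
      (∀ i, ∀ T ∈ N, (∀ x ∈ K i, (T * p i) x = 0) → T * p i = 0) ∧
      -- in particular each summand `N p i` is σ-finite
      (∀ i, ∀ P : Set (H →L[ℂ] H),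
        (∀ q ∈ P, q ∈ N ∧ IsSelfAdjoint q ∧ q * q = q ∧ q ≠ 0 ∧ q * p i = q) →
        (∀ q ∈ P, ∀ r ∈ P, q ≠ r → q * r = 0) → P.Countable) := by
  obtain ⟨S, hS, hSN, hgen⟩ := hgen
  let M : Set (H →L[ℂ] H) := S ∪ star S
  have hMc : M.Countable := hS.union (Set.image_star (s := S) ▸ hS.image _)
  have hMstar : ∀ T ∈ M, star T ∈ M := fun T hT => hT.symm.imp id (by simp)
  have hMN : M ⊆ N := Set.union_subset hSN fun T hT => star_mem_iff.1 (hSN hT)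
  have hcomm : ∀ y : H →L[ℂ] H, (∀ s ∈ M, s * y = y * s) → y ∈ N.commutant := fun y hy =>
    mem_commutant_iff.2 fun _ hx => commutes_of_generates hgen hy hx
  have hinv : ∀ ξ, ∀ T ∈ N, ∀ x ∈ cyclicSubspace M ξ, T x ∈ cyclicSubspace M ξ := by
    intro ξ T hT x hx
    have hTp := mem_commutant_iff.1
      (hcomm _ fun s hs => mul_starProjection_cyclicSubspace hMstar ξ hs) T hT
    rw [← Submodule.starProjection_eq_self_iff] at hx ⊢
    conv_rhs => rw [← hx]
    exact congr($hTp x).symm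
  have hinj : ∀ ξ, ∀ T ∈ N, (∀ x ∈ cyclicSubspace M ξ, T x = 0) →
      T * N.centralProjection ξ = 0 := fun ξ T hT h =>
    mul_centralProjection_eq_zero hT fun a ha => h _ (hinv ξ a ha ξ (mem_cyclicSubspace_self M ξ))
  have hfix : ∀ ξ, ∀ x ∈ cyclicSubspace M ξ, N.centralProjection ξ x = x := fun ξ x hx =>
    Submodule.starProjection_eq_self_iff.2
      (cyclicSubspace_mono (hMN.trans Set.subset_union_left) ξ hx)
  obtain ⟨X, hX0, hXorth, hXsup⟩ := N.exists_maximal_orthogonal_vectors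
  have := (Submonoid.countable_closure hMc).to_subtype
  obtain ⟨e, he⟩ := exists_surjective_nat (Submonoid.closure M)
  -- Vector functionals on a countable set index the family by a type in the lowest universe.
  let f : H → ℕ → ℂ := fun ξ n => ⟪ξ, (e n : H →L[ℂ] H) ξ⟫_ℂ
  have hf : Set.InjOn f X := by
    refine fun ξ hξ η hη h => by_contra fun hne => hX0 η hη ?_
    refine eq_of_inner_apply_eq hMstar hMN hcomm (hXorth hξ hη hne) fun w hw => ?_
    obtain ⟨n, hn⟩ := he ⟨w, hw⟩
    simpa [f, hn] using congrFun h n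
  choose v hvX hfv using fun i : f '' X => i.2
  refine ⟨f '' X, fun i => N.centralProjection (v i), fun i => cyclicSubspace M (v i),
    fun i => N.centralProjection_mem _,
    fun i => (N.isStarProjection_centralProjection _).isSelfAdjoint,
    fun i => (N.isStarProjection_centralProjection _).isIdempotentElem,
    fun i x hx => N.mul_centralProjection _ hx, fun i j hij => ?_, fun x hx => ?_,
    fun i => isClosed_cyclicSubspace M _, fun i => separableSpace_cyclicSubspace hMc _,
    fun i => hfix _, fun i => hinv _, fun i T hT h => hinj _ T hT fun x hx => ?_,
    fun i P hP hPorth => ?_⟩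
  · refine (hXorth (hvX i) (hvX j) fun h => hij ?_).starProjection_comp_starProjection
    exact Subtype.ext ((hfv i).symm.trans (h ▸ hfv j))
  · refine hXsup x fun ξ hξ => ?_
    have hvi : v ⟨f ξ, ξ, hξ, rfl⟩ = ξ := hf (hvX _) hξ (hfv _)
    exact hvi ▸ hx ⟨f ξ, ξ, hξ, rfl⟩
  · simpa [hfix _ x hx] using h x hx
  · have := separableSpace_cyclicSubspace hMc (v i)
    refine countable_of_pairwise_mul_eq_zero (K := cyclicSubspace M (v i))
      (fun q hq => ⟨(hP q hq).2.2.1, (hP q hq).2.1⟩) (fun q hq => ?_) hPorth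
    obtain ⟨hqN, -, -, hq0, hqp⟩ := hP q hq
    by_contra! hcon
    exact hq0 (hqp.symm.trans (hinj _ q hqN fun x hx => hcon x hx (hinv _ q hqN x hx)))
end
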